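/- arXiv:2602.18827 — 2 statements merged into one kernel-verified Lean document; each statement's English description precedes it below -/
import Mathlib

section
/- Unboundedness from below of the free energy (Lemma 4.6): Let d ≥ 3, m > 1+2/d, and M > 0. Then for every B ∈ ℝ there exists a nonnegative smooth compactly supported function u : ℝ^d → ℝ with ∫u dx = M and F(u) < B. In other words, the infimum of F over nonnegative functions of mass M is −∞. -/
open MeasureTheory Real

noncomputable section

/-- The free energy `F(u) = (1/2)∫|∇u|² dx − (1/(m+1))∫u^{m+1} dx`. -/
def freeEnergy {d : ℕ} (m : ℝ) (u : EuclideanSpace ℝ (Fin d) → ℝ) : ℝ :=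
  (1 / 2) * (∫ x, ‖gradient u x‖ ^ 2) - (1 / (m + 1)) * ∫ x, u x ^ (m + 1)

lemma fe_scale {d : ℕ} (m : ℝ) (v : EuclideanSpace ℝ (Fin d) → ℝ) (hv : ∀ x, 0 ≤ v x)
    (hs : ContDiff ℝ (⊤ : ℕ∞) v) (c : ℝ) (hc : 0 < c) :
    freeEnergy m (fun x => c ^ d * v (c • x)) =
      c ^ (d + 2) * ((1 / 2) * ∫ x, ‖gradient v x‖ ^ 2)
        - c ^ ((d : ℝ) * m) * ((1 / (m + 1)) * ∫ x, v x ^ (m + 1)) := by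
  have hcd : (0 : ℝ) < c ^ d := by positivity
  have hn : ∀ (w : EuclideanSpace ℝ (Fin d) → ℝ) x, ‖gradient w x‖ = ‖fderiv ℝ w x‖ := by
    intro w x
    simp [gradient]
  have hg : ∀ x, ‖gradient (fun x => c ^ d * v (c • x)) x‖ ^ 2
      = (c ^ d * c) ^ 2 * ‖gradient v (c • x)‖ ^ 2 := by
    intro x
    have hd : DifferentiableAt ℝ v (c • x) := (hs.differentiable (by simp)) _
    have h1 : HasFDerivAt (fun x : EuclideanSpace ℝ (Fin d) => c • x)
        (c • ContinuousLinearMap.id ℝ (EuclideanSpace ℝ (Fin d))) x :=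
      (hasFDerivAt_id x).const_smul c
    have h2 := (hd.hasFDerivAt.comp x h1).const_mul (c ^ d)
    have h3 : fderiv ℝ (fun x => c ^ d * v (c • x)) x = (c ^ d * c) • fderiv ℝ v (c • x) := by
      refine HasFDerivAt.fderiv (h2.congr_fderiv ?_)
      ext y
      simp
      ring
    rw [hn, hn, h3, norm_smul, mul_pow, Real.norm_of_nonneg (by positivity)]
  have hp : ∀ x, (c ^ d * v (c • x)) ^ (m + 1) = (c ^ d) ^ (m + 1) * (v (c • x)) ^ (m + 1) :=
    fun x => Real.mul_rpow hcd.le (hv _)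
  have i1 := Measure.integral_comp_smul (volume : Measure (EuclideanSpace ℝ (Fin d)))
    (fun x => ‖gradient v x‖ ^ 2) c
  have i2 := Measure.integral_comp_smul (volume : Measure (EuclideanSpace ℝ (Fin d)))
    (fun x => v x ^ (m + 1)) c
  simp only [finrank_euclideanSpace, Fintype.card_fin, smul_eq_mul,
    abs_of_pos (inv_pos.mpr hcd)] at i1 i2
  unfold freeEnergy
  simp only [hg, hp]
  rw [integral_const_mul, integral_const_mul, i1, i2, Real.rpow_add hcd, Real.rpow_one,
    Real.rpow_mul hc.le, Real.rpow_natCast]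
  field_simp
  rw [pow_add]
  ring

/-- **Unboundedness from below of the free energy** (Lemma 4.6). -/
theorem free_energy_unbounded_below (d : ℕ) (hd : 3 ≤ d) (m : ℝ)
    (hm : 1 + 2 / (d : ℝ) < m) (M : ℝ) (hM : 0 < M) :
    ∀ B : ℝ, ∃ u : EuclideanSpace ℝ (Fin d) → ℝ,
      (∀ x, 0 ≤ u x) ∧ ContDiff ℝ (⊤ : ℕ∞) u ∧ HasCompactSupport u ∧
      (∫ x, u x) = M ∧ freeEnergy m u < B := by
  intro B
  have hd0 : (0 : ℝ) < d := by exact_mod_cast (by omega : 0 < d)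
  have hm1 : 1 < m := lt_trans (by have : 0 < 2 / (d : ℝ) := by positivity
                                   linarith) hm
  have hdm : (d : ℝ) + 2 < d * m := by
    have := mul_lt_mul_of_pos_left hm hd0
    rw [mul_add, mul_div_cancel₀ _ hd0.ne'] at this
    linarith
  let f : ContDiffBump (0 : EuclideanSpace ℝ (Fin d)) := ⟨1, 2, one_pos, one_lt_two⟩
  let v : EuclideanSpace ℝ (Fin d) → ℝ := fun x => M * f.normed volume x
  have hv : ∀ x, 0 ≤ v x := fun x => mul_nonneg hM.le (f.nonneg_normed x)
  have hs : ContDiff ℝ (⊤ : ℕ∞) v := contDiff_const.mul f.contDiff_normed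
  have hcs : HasCompactSupport v := f.hasCompactSupport_normed.mul_left
  have hint : ∫ x, v x = M := by
    simp only [v]
    rw [integral_const_mul, f.integral_normed, mul_one]
  have hK : 0 < ∫ x, v x ^ (m + 1) := by
    have hcont : Continuous fun x => v x ^ (m + 1) :=
      hs.continuous.rpow_const (fun x => Or.inr (by linarith))
    have hcs' : HasCompactSupport fun x => v x ^ (m + 1) :=
      hcs.comp_left (g := fun t : ℝ => t ^ (m + 1)) (Real.zero_rpow (by linarith))
    refine hcont.integral_pos_of_hasCompactSupport_nonneg_nonzero hcs'
      (fun x => Real.rpow_nonneg (hv x) _) (x := 0) ?_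
    have : 0 < v 0 := by
      refine mul_pos hM (div_pos ?_ f.integral_pos)
      exact f.pos_of_mem_ball (by simp [f])
    exact (Real.rpow_pos_of_pos this _).ne'
  set A := (1 / 2) * ∫ x, ‖gradient v x‖ ^ 2 with hA
  set K := (1 / (m + 1)) * ∫ x, v x ^ (m + 1) with hKd
  have hK' : 0 < K := mul_pos (by have : 0 < m + 1 := by linarith
                                  positivity) hK
  have ht := tendsto_rpow_atTop (y := (d : ℝ) * m - (d + 2)) (by linarith)
  obtain ⟨c, h1, h2⟩ := ((Filter.eventually_ge_atTop (1 : ℝ)).and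
    (ht.eventually_ge_atTop ((A + |B| + 1) / K))).exists
  have hc : 0 < c := by linarith
  have hcd : (0 : ℝ) < c ^ d := by positivity
  refine ⟨fun x => c ^ d * v (c • x), fun x => mul_nonneg hcd.le (hv _),
    contDiff_const.mul (hs.comp (contDiff_const_smul c)),
    (hcs.comp_smul hc.ne').mul_left, ?_, ?_⟩
  · have i1 := Measure.integral_comp_smul (volume : Measure (EuclideanSpace ℝ (Fin d))) v c
    simp only [finrank_euclideanSpace, Fintype.card_fin, smul_eq_mul,
      abs_of_pos (inv_pos.mpr hcd)] at i1
    rw [integral_const_mul, i1, hint]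
    field_simp
  · rw [fe_scale m v hv hs c hc, ← hA, ← hKd]
    have e : c ^ ((d : ℝ) * m) = c ^ (d + 2) * c ^ ((d : ℝ) * m - (d + 2)) := by
      rw [← Real.rpow_natCast, ← Real.rpow_add hc]
      push_cast
      ring_nf
    rw [e]
    rw [div_le_iff₀ hK'] at h2
    have h3 : 1 ≤ c ^ (d + 2) := one_le_pow₀ h1
    have h4 := neg_abs_le B
    have h5 := abs_nonneg B
    have h6 : c ^ (d + 2) * (A - c ^ ((d : ℝ) * m - (d + 2)) * K)
        ≤ c ^ (d + 2) * (-(|B| + 1)) :=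
      mul_le_mul_of_nonneg_left (by linarith) (by linarith)
    nlinarith
end
end

section
/- Classification of entire positive solutions at the energy-critical exponent (Theorem 3.4(ii), case Ω = ℝ^d): Let d ≥ 3 and let U : ℝ^d → ℝ be a twice continuously differentiable function with U(x) > 0 for all x, satisfying −ΔU(x) = U(x)^{(d+2)/(d−2)} for every x ∈ ℝ^d and U(x) → 0 as ‖x‖ → ∞. Then there exist λ > 0 and x₀ ∈ ℝ^d such that U(x) = (√(d(d−2)) λ / (λ² + ‖x−x₀‖²))^{(d−2)/2} for all x ∈ ℝ^d. -/
open Real Filter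

noncomputable section

/-- The Laplacian of a function on `ℝ^d`, as the trace of its second derivative
computed in the standard orthonormal basis. -/
def laplacian {d : ℕ} (u : EuclideanSpace ℝ (Fin d) → ℝ)
    (x : EuclideanSpace ℝ (Fin d)) : ℝ :=
  ∑ i : Fin d,
    fderiv ℝ (fun y => fderiv ℝ u y (EuclideanSpace.single i 1)) x
      (EuclideanSpace.single i 1)

open Topology

/-- standard basis vector -/
abbrev eb {d : ℕ} (i : Fin d) : EuclideanSpace ℝ (Fin d) := EuclideanSpace.single i 1

/-- Pointwise Laplacian along coordinate lines. -/
def HasLap {d : ℕ} (f : EuclideanSpace ℝ (Fin d) → ℝ) (y : EuclideanSpace ℝ (Fin d)) (L : ℝ) : Prop :=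
  ∃ (g : Fin d → ℝ → ℝ) (D : Fin d → ℝ),
    (∀ i, ∀ᶠ t in 𝓝 (0:ℝ), HasDerivAt (fun t : ℝ => f (y + t • eb i)) (g i t) t) ∧
    (∀ i, HasDerivAt (g i) (D i) 0) ∧ ∑ i, D i = L

section A
variable {d : ℕ} {f f₁ f₂ : EuclideanSpace ℝ (Fin d) → ℝ} {y : EuclideanSpace ℝ (Fin d)} {L L₁ L₂ : ℝ}

lemma HasLap.add (h₁ : HasLap f₁ y L₁) (h₂ : HasLap f₂ y L₂) :
    HasLap (fun z => f₁ z + f₂ z) y (L₁ + L₂) := by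
  obtain ⟨g₁, D₁, a₁, b₁, c₁⟩ := h₁
  obtain ⟨g₂, D₂, a₂, b₂, c₂⟩ := h₂
  refine ⟨fun i t => g₁ i t + g₂ i t, fun i => D₁ i + D₂ i, fun i => ?_, fun i => (b₁ i).add (b₂ i), ?_⟩
  · filter_upwards [a₁ i, a₂ i] with t h h'
    exact h.add h'
  · rw [Finset.sum_add_distrib, c₁, c₂]

lemma HasLap.const_mul (c : ℝ) (h₁ : HasLap f₁ y L₁) :
    HasLap (fun z => c * f₁ z) y (c * L₁) := by
  obtain ⟨g₁, D₁, a₁, b₁, c₁⟩ := h₁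
  refine ⟨fun i t => c * g₁ i t, fun i => c * D₁ i, fun i => ?_, fun i => (b₁ i).const_mul c, ?_⟩
  · filter_upwards [a₁ i] with t h
    exact h.const_mul c
  · rw [← Finset.mul_sum, c₁]

lemma HasLap.const (c : ℝ) (y : EuclideanSpace ℝ (Fin d)) : HasLap (fun _ => c) y 0 := by
  refine ⟨fun i t => 0, fun i => 0, fun i => ?_, fun i => hasDerivAt_const _ _, by simp⟩
  exact Eventually.of_forall fun t => hasDerivAt_const _ _

lemma HasLap.sub (h₁ : HasLap f₁ y L₁) (h₂ : HasLap f₂ y L₂) :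
    HasLap (fun z => f₁ z - f₂ z) y (L₁ - L₂) := by
  have := h₁.add (h₂.const_mul (-1))
  simpa [sub_eq_add_neg] using this

lemma HasLap.comp_add (a : EuclideanSpace ℝ (Fin d)) (h : HasLap f (a + y) L) :
    HasLap (fun z => f (a + z)) y L := by
  obtain ⟨g, D, p, q, r⟩ := h
  exact ⟨g, D, fun i => by simpa [add_assoc] using p i, q, r⟩

lemma HasLap.sq_norm (y : EuclideanSpace ℝ (Fin d)) : HasLap (fun z => ‖z‖^2) y (2 * d) := by
  refine ⟨fun i t => 2 * (inner ℝ y (eb i) + t), fun i => 2, fun i => ?_, fun i => ?_, by simp [mul_comm]⟩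
  · refine Eventually.of_forall fun t => ?_
    have : (fun t : ℝ => ‖y + t • eb i‖^2) = fun t => ‖y‖^2 + 2 * (t * inner ℝ y (eb i)) + t^2 := by
      ext t
      rw [norm_add_sq_real, inner_smul_right, norm_smul]
      simp
    rw [this]
    have := (((hasDerivAt_id t).mul_const (inner ℝ y (eb i))).const_mul 2).const_add (‖y‖^2) |>.add
      ((hasDerivAt_id t).pow 2)
    refine this.congr_deriv ?_
    simp; ring
  · simpa using ((hasDerivAt_id (0:ℝ)).const_add (inner ℝ y (eb i))).const_mul 2

lemma HasLap.nonneg_of_isLocalMin (h : HasLap f y L) (hm : IsLocalMin f y) : 0 ≤ L := by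
  obtain ⟨g, D, p, q, rfl⟩ := h
  refine Finset.sum_nonneg fun i _ => ?_
  by_contra! hD
  set φ : ℝ → ℝ := fun t => f (y + t • eb i) with hφ
  have hc : Tendsto (fun t : ℝ => y + t • eb i) (𝓝 0) (𝓝 y) := by
    have : Continuous (fun t : ℝ => y + t • eb i) := by fun_prop
    simpa using this.tendsto 0
  have hmin : IsLocalMin φ 0 := by
    have := hc.eventually hm
    filter_upwards [this] with t ht
    simpa [hφ] using ht
  have hd : deriv φ =ᶠ[𝓝 0] g i := by
    filter_upwards [p i] with t ht using ht.deriv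
  have hdd : deriv (deriv φ) 0 = D i := by
    rw [hd.deriv_eq]; exact (q i).deriv
  have h0 : deriv φ 0 = 0 := hmin.deriv_eq_zero
  have hmax : IsLocalMax φ 0 := by
    apply isLocalMax_of_deriv_deriv_neg (by rw [hdd]; exact hD) h0
    exact (p i).self_of_nhds.continuousAt
  have hconst : φ =ᶠ[𝓝 0] fun _ => φ 0 := by
    filter_upwards [hmin, hmax] with t h1 h2 using le_antisymm h2 h1
  have := hconst.deriv.deriv_eq
  rw [hdd] at this
  simp at this
  linarith

lemma HasLap.of_contDiff (hf : ContDiff ℝ 2 f) (y) : HasLap f y (laplacian f y) := by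
  have h1 : ContDiff ℝ 1 (fderiv ℝ f) := hf.fderiv_right (by norm_num)
  refine ⟨fun i t => fderiv ℝ f (y + t • eb i) (eb i), _, fun i => ?_, fun i => ?_, rfl⟩
  · refine Eventually.of_forall fun t => ?_
    have hl : HasDerivAt (fun t : ℝ => y + t • eb i) (eb i) t := by
      simpa using ((hasDerivAt_id t).smul_const (eb i)).const_add y
    exact ((hf.differentiable (by norm_num)) _).hasFDerivAt.comp_hasDerivAt t hl
  · have hl : HasDerivAt (fun t : ℝ => y + t • eb i) (eb i) 0 := by
      simpa using ((hasDerivAt_id (0:ℝ)).smul_const (eb i)).const_add y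
    have h2 : Differentiable ℝ (fun z => fderiv ℝ f z (eb i)) :=
      fun z => ((h1.differentiable (by norm_num)) z).clm_apply (differentiableAt_const _)
    have := (h2 (y + (0:ℝ) • eb i)).hasFDerivAt.comp_hasDerivAt 0 hl
    rw [zero_smul, add_zero] at this
    exact this

lemma HasLap.unique (h₁ : HasLap f y L₁) (h₂ : HasLap f y L₂) : L₁ = L₂ := by
  obtain ⟨g₁, D₁, a₁, b₁, rfl⟩ := h₁
  obtain ⟨g₂, D₂, a₂, b₂, rfl⟩ := h₂
  refine Finset.sum_congr rfl fun i _ => ?_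
  have : g₁ i =ᶠ[𝓝 0] g₂ i := by
    filter_upwards [a₁ i, a₂ i] with t h h' using h.unique h'
  exact (b₁ i).unique ((b₂ i).congr_of_eventuallyEq this)

/-- weak maximum principle -/
lemma weak_max (hd : 0 < d) {K Ω : Set (EuclideanSpace ℝ (Fin d))} (hK : IsCompact K)
    (hΩ : IsOpen Ω) (hΩK : Ω ⊆ K) (hf : ContinuousOn f K)
    (hlap : ∀ y ∈ Ω, ∃ L ≤ 0, HasLap f y L) (hb : ∀ y ∈ K, y ∉ Ω → 0 ≤ f y) :
    ∀ y ∈ K, 0 ≤ f y := by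
  intro y₀ hy₀
  by_contra! hneg
  obtain ⟨R, hR⟩ := hK.isBounded.exists_norm_le
  have hR0 : 0 ≤ R := (norm_nonneg _).trans (hR y₀ hy₀)
  set ε := -f y₀ / (2 * (R^2 + 1)) with hε
  have hεpos : 0 < ε := by apply div_pos <;> nlinarith
  have hεR : ε * R^2 < - f y₀ := by
    rw [hε, div_mul_eq_mul_div, div_lt_iff₀ (by positivity)]
    nlinarith [sq_nonneg R]
  set g : EuclideanSpace ℝ (Fin d) → ℝ := fun z => f z + (ε * R^2 + (-ε) * ‖z‖^2) with hg
  have hgc : ContinuousOn g K := hf.add (by fun_prop)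
  obtain ⟨z, hzK, hz⟩ := hK.exists_isMinOn ⟨y₀, hy₀⟩ hgc
  have hgz : g z < 0 := by
    have := hz hy₀
    simp only [Set.mem_ofPred_eq] at this
    have h2 : g y₀ < 0 := by simp only [hg]; nlinarith [sq_nonneg ‖y₀‖]
    linarith
  have hzΩ : z ∈ Ω := by
    by_contra hc
    have := hb z hzK hc
    have h3 : ‖z‖^2 ≤ R^2 := pow_le_pow_left₀ (norm_nonneg _) (hR z hzK) 2
    simp only [hg] at hgz
    nlinarith
  have hmin : IsLocalMin g z := by
    filter_upwards [hΩ.mem_nhds hzΩ] with w hw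
    exact hz (hΩK hw)
  obtain ⟨L, hL, hLf⟩ := hlap z hzΩ
  have := (hLf.add ((HasLap.const (ε * R^2) z).add ((HasLap.sq_norm z).const_mul (-ε)))).nonneg_of_isLocalMin hmin
  have hd' : (0:ℝ) < d := by exact_mod_cast hd
  nlinarith [mul_pos hεpos hd']

end A

section B
variable {d : ℕ}

lemma hasDerivAt_line (y e : EuclideanSpace ℝ (Fin d)) (t : ℝ) :
    HasDerivAt (fun t : ℝ => y + t • e) e t := by
  simpa using ((hasDerivAt_id t).smul_const e).const_add y

lemma hasDerivAt_qpow (y e : EuclideanSpace ℝ (Fin d)) (he : ‖e‖ = 1) (t : ℝ) (ht : y + t • e ≠ 0) (k : ℕ) :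
    HasDerivAt (fun t : ℝ => (‖y + t • e‖⁻¹)^k)
      (-k * (‖y + t • e‖⁻¹)^(k+2) * (inner ℝ y e + t)) t := by
  have hN : 0 < ‖y + t • e‖ := norm_pos_iff.mpr ht
  have h1 : HasDerivAt (fun t : ℝ => ‖y + t • e‖^2) (2 * inner ℝ (y + t • e) e) t :=
    (hasDerivAt_line y e t).norm_sq
  have h2 : HasDerivAt (fun t : ℝ => ‖y + t • e‖) (‖y + t • e‖⁻¹ * (inner ℝ y e + t)) t := by
    have := h1.sqrt (by positivity)
    simp only [Real.sqrt_sq (norm_nonneg _)] at this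
    refine this.congr_deriv ?_
    rw [inner_add_left, inner_smul_left, real_inner_self_eq_norm_sq, he]
    simp; field_simp
  have h3 := (h2.inv hN.ne').pow k
  refine h3.congr_deriv ?_
  rcases k with _ | k
  · simp
  · simp only [Nat.add_sub_cancel, Pi.inv_apply, div_eq_mul_inv, ← inv_pow]
    ring

lemma hasDerivAt_gamma (y e : EuclideanSpace ℝ (Fin d)) (he : ‖e‖ = 1) (t : ℝ) (ht : y + t • e ≠ 0) (c : ℝ) :
    HasDerivAt (fun t : ℝ => (c * ‖y + t • e‖⁻¹^2) • (y + t • e))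
      ((c * (-2 * ‖y + t • e‖⁻¹^4 * (inner ℝ y e + t))) • (y + t • e) + (c * ‖y + t • e‖⁻¹^2) • e) t := by
  have h := ((hasDerivAt_qpow y e he t ht 2).const_mul c).smul (hasDerivAt_line y e t)
  refine h.congr_deriv ?_
  rw [add_comm]; push_cast; rfl

lemma hasDerivAt_gamma' (y e : EuclideanSpace ℝ (Fin d)) (he : ‖e‖ = 1) (t : ℝ) (ht : y + t • e ≠ 0) (c : ℝ) :
    HasDerivAt (fun t : ℝ => (c * (-2 * ‖y + t • e‖⁻¹^4 * (inner ℝ y e + t))) • (y + t • e) + (c * ‖y + t • e‖⁻¹^2) • e)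
      ((c * (8 * ‖y + t • e‖⁻¹^6 * (inner ℝ y e + t)^2 - 2 * ‖y + t • e‖⁻¹^4)) • (y + t • e) +
        (c * (-4 * ‖y + t • e‖⁻¹^4 * (inner ℝ y e + t))) • e) t := by
  have hb : HasDerivAt (fun t : ℝ => inner ℝ y e + t) 1 t := (hasDerivAt_id t).const_add _
  have h1 := (((((hasDerivAt_qpow y e he t ht 4).const_mul (-2)).mul hb).const_mul c).smul (hasDerivAt_line y e t)).add
   (((hasDerivAt_qpow y e he t ht 2).const_mul c).smul_const e)
  refine h1.congr_deriv ?_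
  simp only [Pi.mul_apply]
  push_cast
  module

lemma hasDerivAt_kelvin1 (m : ℕ) (u : EuclideanSpace ℝ (Fin d) → ℝ) (hu : ContDiff ℝ 2 u)
    (y e : EuclideanSpace ℝ (Fin d)) (he : ‖e‖ = 1) (t : ℝ) (ht : y + t • e ≠ 0) (c : ℝ) :
    HasDerivAt (fun t : ℝ => ‖y + t • e‖⁻¹^m * u ((c * ‖y + t • e‖⁻¹^2) • (y + t • e)))
      (-m * ‖y + t • e‖⁻¹^(m+2) * (inner ℝ y e + t) * u ((c * ‖y + t • e‖⁻¹^2) • (y + t • e))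
      + ‖y + t • e‖⁻¹^m * fderiv ℝ u ((c * ‖y + t • e‖⁻¹^2) • (y + t • e))
        ((c * (-2 * ‖y + t • e‖⁻¹^4 * (inner ℝ y e + t))) • (y + t • e) + (c * ‖y + t • e‖⁻¹^2) • e)) t := by
  exact (hasDerivAt_qpow y e he t ht m).mul
    (((hu.differentiable (by norm_num)) _).hasFDerivAt.comp_hasDerivAt t (hasDerivAt_gamma y e he t ht c))

lemma hasDerivAt_kelvin2 (m : ℕ) (u : EuclideanSpace ℝ (Fin d) → ℝ) (hu : ContDiff ℝ 2 u)
    (y e : EuclideanSpace ℝ (Fin d)) (he : ‖e‖ = 1) (t : ℝ) (ht : y + t • e ≠ 0) (c : ℝ)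
    (q b : ℝ) (hq : q = ‖y + t • e‖⁻¹) (hb : b = inner ℝ y e + t) (z w : EuclideanSpace ℝ (Fin d))
    (hz : z = (c * q^2) • (y + t • e))
    (hw : w = (c * (-2 * q^4 * b)) • (y + t • e) + (c * q^2) • e) :
    HasDerivAt (fun t : ℝ =>
      (-m * ‖y + t • e‖⁻¹^(m+2) * (inner ℝ y e + t) * u ((c * ‖y + t • e‖⁻¹^2) • (y + t • e))
      + ‖y + t • e‖⁻¹^m * fderiv ℝ u ((c * ‖y + t • e‖⁻¹^2) • (y + t • e))
        ((c * (-2 * ‖y + t • e‖⁻¹^4 * (inner ℝ y e + t))) • (y + t • e) + (c * ‖y + t • e‖⁻¹^2) • e)))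
      ((m * (m+2) * q^(m+4) * b^2 - m * q^(m+2)) * u z - 2 * m * q^(m+2) * b * fderiv ℝ u z w
        + q^m * (fderiv ℝ (fderiv ℝ u) z w w + fderiv ℝ u z
          ((c * (8 * q^6 * b^2 - 2 * q^4)) • (y + t • e) + (c * (-4 * q^4 * b)) • e))) t := by
  have h1 : ContDiff ℝ 1 (fderiv ℝ u) := hu.fderiv_right (by norm_num)
  have hbt : HasDerivAt (fun t : ℝ => inner ℝ y e + t) 1 t := (hasDerivAt_id t).const_add _
  have hG := hasDerivAt_gamma y e he t ht c
  have hU := ((hu.differentiable (by norm_num)) ((c * ‖y + t • e‖⁻¹^2) • (y + t • e))).hasFDerivAt.comp_hasDerivAt t hG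
  have hDU := ((h1.differentiable (by norm_num)) ((c * ‖y + t • e‖⁻¹^2) • (y + t • e))).hasFDerivAt.comp_hasDerivAt t hG
  have hA := (((hasDerivAt_qpow y e he t ht (m+2)).const_mul (-m : ℝ)).mul hbt).mul hU
  have hB := (hasDerivAt_qpow y e he t ht m).mul (hDU.clm_apply (hasDerivAt_gamma' y e he t ht c))
  refine (hA.add hB).congr_deriv ?_
  simp only [Function.comp, Pi.mul_apply]
  rw [← hb, ← hq, ← hz, ← hw]
  push_cast
  ring

lemma sum_inner_smul_eb (y : EuclideanSpace ℝ (Fin d)) : ∑ i, (inner ℝ y (eb i)) • eb i = y := by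
  ext j
  simp [eb, EuclideanSpace.inner_single_right, Finset.sum_apply, Pi.single_apply]

lemma sum_inner_sq_eb (y : EuclideanSpace ℝ (Fin d)) : ∑ i, (inner ℝ y (eb i))^2 = ‖y‖^2 := by
  rw [EuclideanSpace.norm_sq_eq]
  simp [eb, EuclideanSpace.inner_single_right]

lemma laplacian_eq (u : EuclideanSpace ℝ (Fin d) → ℝ) (hu : ContDiff ℝ 2 u) (z) :
    laplacian u z = ∑ i, fderiv ℝ (fderiv ℝ u) z (eb i) (eb i) := by
  have h1 : ContDiff ℝ 1 (fderiv ℝ u) := hu.fderiv_right (by norm_num)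
  refine Finset.sum_congr rfl fun i _ => ?_
  rw [fderiv_clm_apply ((h1.differentiable (by norm_num)) z) (differentiableAt_const _)]
  simp

lemma kelvin_lap {m : ℕ} (u : EuclideanSpace ℝ (Fin (m+2)) → ℝ) (hu : ContDiff ℝ 2 u) (c : ℝ)
    (y : EuclideanSpace ℝ (Fin (m+2))) (hy : y ≠ 0) :
    HasLap (fun z => ‖z‖⁻¹^m * u ((c * ‖z‖⁻¹^2) • z)) y
      (c^2 * ‖y‖⁻¹^(m+4) * laplacian u ((c * ‖y‖⁻¹^2) • y)) := by
  have hne (i : Fin (m+2)) : ∀ᶠ t in 𝓝 (0:ℝ), y + t • eb i ≠ 0 := by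
    have : Continuous (fun t : ℝ => y + t • eb i) := by fun_prop
    apply this.continuousAt.eventually_ne
    simpa using hy
  have he (i : Fin (m+2)) : ‖(eb i : EuclideanSpace ℝ (Fin (m+2)))‖ = 1 := by simp
  set q := ‖y‖⁻¹ with hq
  set z := (c * q^2) • y with hz
  set w : Fin (m+2) → EuclideanSpace ℝ (Fin (m+2)) := fun i => (c * (-2 * q^4 * inner ℝ y (eb i))) • y + (c * q^2) • eb i with hw
  refine ⟨fun i t => (-m * ‖y + t • eb i‖⁻¹^(m+2) * (inner ℝ y (eb i) + t) * u ((c * ‖y + t • eb i‖⁻¹^2) • (y + t • eb i))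
      + ‖y + t • eb i‖⁻¹^m * fderiv ℝ u ((c * ‖y + t • eb i‖⁻¹^2) • (y + t • eb i))
        ((c * (-2 * ‖y + t • eb i‖⁻¹^4 * (inner ℝ y (eb i) + t))) • (y + t • eb i) + (c * ‖y + t • eb i‖⁻¹^2) • eb i)), fun i => ((m * (m+2) * q^(m+4) * (inner ℝ y (eb i))^2 - m * q^(m+2)) * u z - 2 * m * q^(m+2) * inner ℝ y (eb i) * fderiv ℝ u z (w i)
        + q^m * (fderiv ℝ (fderiv ℝ u) z (w i) (w i) + fderiv ℝ u z
          ((c * (8 * q^6 * (inner ℝ y (eb i))^2 - 2 * q^4)) • y + (c * (-4 * q^4 * inner ℝ y (eb i))) • eb i))), fun i => ?_, fun i => ?_, ?_⟩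
  rotate_left
  · have := hasDerivAt_kelvin2 m u hu y (eb i) (he i) 0 (by simpa using hy) c q (inner ℝ y (eb i))
      (by simp [hq]) (by simp) z (w i) (by simp [hz]) (by simp [hw])
    rw [zero_smul, add_zero] at this
    exact this
  · rw [laplacian_eq u hu]
    have hn : ‖y‖ ≠ 0 := by simpa using hy
    have hqy : q^2 * ‖y‖^2 = 1 := by rw [hq]; field_simp
    set S := ∑ i, fderiv ℝ (fderiv ℝ u) z (eb i) (eb i) with hS
    set B := fderiv ℝ (fderiv ℝ u) z with hB
    set A := fderiv ℝ u z with hA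
    set b : Fin (m+2) → ℝ := fun i => inner ℝ y (eb i) with hb
    have e1 : ∑ i, (b i)^2 = ‖y‖^2 := sum_inner_sq_eb y
    have e2 : ∑ i, b i * A (eb i) = A y := by
      conv_rhs => rw [← sum_inner_smul_eb y]
      simp [map_sum]
      rfl
    have e3 : ∑ i, b i * B y (eb i) = B y y := by
      conv_rhs => rw [← sum_inner_smul_eb y]
      rw [map_sum, sum_inner_smul_eb y]
      simp
      rfl
    have e4 : ∑ i, b i * B (eb i) y = B y y := by
      have h : B.flip y y = ∑ i, b i * B.flip y (eb i) := by
        conv_lhs => rw [← sum_inner_smul_eb y]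
        rw [map_sum, sum_inner_smul_eb y]
        simp
        rfl
      simpa using h.symm
    have key (i : Fin (m+2)) : ((m * (m+2) * q^(m+4) * (inner ℝ y (eb i))^2 - m * q^(m+2)) * u z - 2 * m * q^(m+2) * inner ℝ y (eb i) * A (w i)
        + q^m * (B (w i) (w i) + A
          ((c * (8 * q^6 * (inner ℝ y (eb i))^2 - 2 * q^4)) • y + (c * (-4 * q^4 * inner ℝ y (eb i))) • eb i))) =
        (m * (m+2) * q^(m+4) * u z + 4 * m * c * q^(m+6) * A y + 4 * c^2 * q^(m+8) * B y y + 8 * c * q^(m+6) * A y) * (b i)^2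
        + (-m * q^(m+2) * u z - 2 * c * q^(m+4) * A y) 
        + (-2 * m * c * q^(m+4) - 4 * c * q^(m+4)) * (b i * A (eb i))
        + (- 2 * c^2 * q^(m+6)) * (b i * B y (eb i)) 
        + (- 2 * c^2 * q^(m+6)) * (b i * B (eb i) y)
        + c^2 * q^(m+4) * B (eb i) (eb i) := by
      simp only [hw, map_add, map_smul, add_apply, smul_apply, smul_eq_mul, hb]
      ring
    rw [Finset.sum_congr rfl fun i _ => key i]
    simp only [Finset.sum_add_distrib, ← Finset.mul_sum, e1, e2, e3, e4, ← hS]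
    simp only [Finset.sum_const, Finset.card_univ, Fintype.card_fin, nsmul_eq_mul]
    push_cast
    linear_combination (m * (m+2) * q^(m+2) * u z + 4 * m * c * q^(m+4) * A y + 4 * c^2 * q^(m+6) * B y y + 8 * c * q^(m+4) * A y) * hqy
  · filter_upwards [hne i] with t ht
    exact hasDerivAt_kelvin1 m u hu y (eb i) (he i) t ht c

end B

section C
variable {m : ℕ}

lemma harm_pow (a y : EuclideanSpace ℝ (Fin (m+2))) (hy : 0 < ‖y - a‖) :
    HasLap (fun z => ‖z - a‖⁻¹^m) y 0 := by
  have h := kelvin_lap (m := m) (fun _ => 1) contDiff_const 1 (-a + y) (by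
    intro h; rw [neg_add_eq_sub] at h; simp [h] at hy)
  have h0 : laplacian (fun _ : EuclideanSpace ℝ (Fin (m+2)) => (1:ℝ)) = fun _ => 0 := by
    ext z; simp [laplacian]
  rw [h0] at h
  have := h.comp_add
  simpa [neg_add_eq_sub] using this

lemma annulus_compare (a : EuclideanSpace ℝ (Fin (m+2))) {r₁ r₂ A B : ℝ} (hr : 0 < r₁)
    {w : EuclideanSpace ℝ (Fin (m+2)) → ℝ}
    (hc : ContinuousOn w {y | r₁ ≤ ‖y - a‖ ∧ ‖y - a‖ ≤ r₂})
    (hs : ∀ y, r₁ < ‖y - a‖ → ‖y - a‖ < r₂ → ∃ L ≤ 0, HasLap w y L)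
    (h1 : ∀ y, ‖y - a‖ = r₁ → A + B * r₁⁻¹^m ≤ w y)
    (h2 : ∀ y, ‖y - a‖ = r₂ → A + B * r₂⁻¹^m ≤ w y) (y : EuclideanSpace ℝ (Fin (m+2)))
    (hy1 : r₁ ≤ ‖y - a‖) (hy2 : ‖y - a‖ ≤ r₂) : A + B * ‖y - a‖⁻¹^m ≤ w y := by
  have hcont : Continuous fun y : EuclideanSpace ℝ (Fin (m+2)) => ‖y - a‖ := by fun_prop
  have hK : IsCompact {y | r₁ ≤ ‖y - a‖ ∧ ‖y - a‖ ≤ r₂} := by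
    apply Metric.isCompact_of_isClosed_isBounded
    · exact (isClosed_le continuous_const hcont).inter (isClosed_le hcont continuous_const)
    · refine (Metric.isBounded_closedBall (x := a) (r := r₂)).subset fun y hy => ?_
      simpa [dist_eq_norm] using hy.2
  have hΩ : IsOpen {y | r₁ < ‖y - a‖ ∧ ‖y - a‖ < r₂} :=
    (isOpen_lt continuous_const hcont).inter (isOpen_lt hcont continuous_const)
  have := weak_max (f := fun y => w y - (A + B * ‖y - a‖⁻¹^m)) (by omega) hK hΩ
    (fun y hy => ⟨hy.1.le, hy.2.le⟩) ?_ ?_ ?_ y ⟨hy1, hy2⟩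
  · linarith
  · refine hc.sub (continuousOn_const.add (continuousOn_const.mul (ContinuousOn.pow (ContinuousOn.inv₀ hcont.continuousOn ?_) m)))
    intro y hy
    exact (lt_of_lt_of_le hr hy.1).ne'
  · intro y hy
    obtain ⟨L, hL, hl⟩ := hs y hy.1 hy.2
    refine ⟨_, ?_, hl.sub ((HasLap.const A y).add ((harm_pow a y (hr.trans hy.1)).const_mul B))⟩
    simpa using hL
  · intro y hy hn
    have : ‖y - a‖ = r₁ ∨ ‖y - a‖ = r₂ := by
      by_contra! hh
      exact hn ⟨lt_of_le_of_ne hy.1 hh.1.symm, lt_of_le_of_ne hy.2 hh.2⟩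
    rcases this with h | h
    · have := h1 y h; rw [← h] at this; linarith
    · have := h2 y h; rw [← h] at this; linarith

lemma outer_lower (hm : 1 ≤ m) {R c : ℝ} (hR : 0 < R)
    {w : EuclideanSpace ℝ (Fin (m+2)) → ℝ}
    (hc : ContinuousOn w {y | R ≤ ‖y‖})
    (hs : ∀ y, R < ‖y‖ → ∃ L ≤ 0, HasLap w y L) (hw : ∀ y, R ≤ ‖y‖ → 0 ≤ w y)
    (h1 : ∀ y, ‖y‖ = R → c ≤ w y) (y : EuclideanSpace ℝ (Fin (m+2))) (hy : R ≤ ‖y‖) :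
    c * R^m * ‖y‖⁻¹^m ≤ w y := by
  apply le_of_forall_pos_le_add
  intro ε hε
  have ht : Tendsto (fun r : ℝ => c * R^m * r⁻¹^m) atTop (𝓝 0) := by
    have := (tendsto_inv_atTop_zero.pow m).const_mul (c * R^m) (M := ℝ)
    rwa [zero_pow (by omega), mul_zero] at this
  obtain ⟨r, hr1, hr2⟩ := ((ht.eventually (gt_mem_nhds hε)).and (eventually_ge_atTop ‖y‖)).exists
  have := annulus_compare (m := m) 0 (r₁ := R) (r₂ := r) (A := -ε) (B := c * R^m) hR (w := w)
    (hc.mono fun z hz => by simpa using hz.1) (fun z h _ => hs z (by simpa using h)) ?_ ?_ y (by simpa using hy) (by simpa using hr2)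
  · simp only [sub_zero] at this; linarith
  · intro z hz
    have := h1 z (by simpa using hz)
    have h3 : R^m * R⁻¹^m = 1 := by rw [← mul_pow, mul_inv_cancel₀ hR.ne', one_pow]
    rw [mul_assoc, h3]; linarith
  · intro z hz
    have := hw z (by simp at hz; linarith)
    linarith

lemma ball_pos (hm : 1 ≤ m) {R : ℝ} {a : EuclideanSpace ℝ (Fin (m+2))}
    {w : EuclideanSpace ℝ (Fin (m+2)) → ℝ}
    (hc : ContinuousOn w (Metric.closedBall a R))
    (hs : ∀ y ∈ Metric.closedBall a R, ∃ L ≤ 0, HasLap w y L)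
    (hw : ∀ y ∈ Metric.closedBall a R, 0 ≤ w y)
    (ha : 0 < w a) : ∀ y ∈ Metric.ball a R, 0 < w y := by
  intro y hy
  have hR : 0 < R := Metric.pos_of_mem_ball hy
  have hca : ContinuousAt w a := hc.continuousAt (Metric.closedBall_mem_nhds a hR)
  have : ∀ᶠ z in 𝓝 a, w a / 2 < w z := hca.eventually (lt_mem_nhds (by linarith))
  obtain ⟨ρ₀, hρ₀, hρ⟩ := Metric.eventually_nhds_iff.mp this
  set ρ := min (ρ₀/2) (R/2) with hρd
  have hρpos : 0 < ρ := by positivity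
  have hρR : ρ < R := (min_le_right _ _).trans_lt (by linarith)
  have hρ1 : ∀ z, ‖z - a‖ ≤ ρ → w a / 2 < w z := fun z hz => hρ (by
    rw [dist_eq_norm]; have := min_le_left (ρ₀/2) (R/2); linarith)
  rw [Metric.mem_ball, dist_eq_norm] at hy
  by_cases h : ‖y - a‖ ≤ ρ
  · linarith [hρ1 y h]
  push Not at h
  have hlt : ∀ s t : ℝ, 0 < s → s < t → t⁻¹^m < s⁻¹^m := fun s t hs hst => by
    apply pow_lt_pow_left₀ _ (by have := hs.trans hst; positivity) (by omega)
    exact inv_strictAnti₀ hs hst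
  have hδ := hlt ρ R hρpos hρR
  set c := (w a / 2) / (ρ⁻¹^m - R⁻¹^m) with hcd
  have hcpos : 0 < c := div_pos (by linarith) (by linarith)
  have hmul : c * (ρ⁻¹^m - R⁻¹^m) = w a / 2 := by
    rw [hcd]; exact div_mul_cancel₀ _ (by linarith)
  have := annulus_compare (m := m) a (r₁ := ρ) (r₂ := R) (A := -(c * R⁻¹^m)) (B := c) hρpos (w := w)
    (hc.mono fun z hz => by simpa [dist_eq_norm] using hz.2) 
    (fun z _ h => hs z (by simpa [dist_eq_norm] using h.le)) ?_ ?_ y h.le hy.le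
  · have h2 := hlt _ _ (hρpos.trans h) hy
    nlinarith
  · intro z hz
    have := hρ1 z hz.le
    linarith
  · intro z hz
    have := hw z (by simp [dist_eq_norm, hz])
    linarith

lemma isPreconnected_ext {l : ℝ} (hl : 0 ≤ l) :
    IsPreconnected {y : EuclideanSpace ℝ (Fin (m+2)) | l < ‖y‖} := by
  have h0 : IsPreconnected ({0}ᶜ : Set (EuclideanSpace ℝ (Fin (m+2)))) := by
    refine (isConnected_compl_singleton_of_one_lt_rank ?_ 0).isPreconnected
    rw [← Module.finrank_eq_rank, finrank_euclideanSpace_fin]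
    exact_mod_cast (by omega : 1 < m + 2)
  have h1 : ContinuousOn (fun y : EuclideanSpace ℝ (Fin (m+2)) => (1 + l * ‖y‖⁻¹) • y) {0}ᶜ := by
    have hh : ContinuousOn (fun y : EuclideanSpace ℝ (Fin (m+2)) => 1 + l * ‖y‖⁻¹) {0}ᶜ := ?_
    · exact hh.smul continuousOn_id
    refine continuousOn_const.add (continuousOn_const.mul (continuous_norm.continuousOn.inv₀ ?_))
    intro y hy; simpa using hy
  convert h0.image _ h1 using 1
  ext z
  simp only [Set.mem_ofPred_eq, Set.mem_image, Set.mem_compl_iff, Set.mem_singleton_iff]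
  constructor
  · intro hz
    have hz0 : 0 < ‖z‖ := hl.trans_lt hz
    have hpos : 0 < 1 - l * ‖z‖⁻¹ := by
      rw [sub_pos, ← div_eq_mul_inv, div_lt_one hz0]; exact hz
    refine ⟨(1 - l * ‖z‖⁻¹) • z, by simp [hpos.ne', norm_pos_iff.mp hz0], ?_⟩
    rw [smul_smul, norm_smul, Real.norm_of_nonneg hpos.le]
    have : (1 + l * ((1 - l * ‖z‖⁻¹) * ‖z‖)⁻¹) * (1 - l * ‖z‖⁻¹) = 1 := by
      have h2 : ‖z‖ - l ≠ 0 := by linarith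
      field_simp
      ring
    rw [this, one_smul]
  · rintro ⟨y, hy, rfl⟩
    have hy0 : 0 < ‖y‖ := norm_pos_iff.mpr hy
    rw [norm_smul, Real.norm_of_nonneg (by positivity)]
    have : (1 + l * ‖y‖⁻¹) * ‖y‖ = ‖y‖ + l := by field_simp
    linarith

lemma strong_pos (hm : 1 ≤ m) {l : ℝ} (hl : 0 ≤ l)
    {w : EuclideanSpace ℝ (Fin (m+2)) → ℝ}
    (hc : ContinuousOn w {y | l < ‖y‖})
    (hs : ∀ y, l < ‖y‖ → ∃ L ≤ 0, HasLap w y L)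
    (hw : ∀ y, l < ‖y‖ → 0 ≤ w y) (a : EuclideanSpace ℝ (Fin (m+2))) (hla : l < ‖a‖)
    (ha : 0 < w a) : ∀ y, l < ‖y‖ → 0 < w y := by
  have hball : ∀ b R, R < ‖b‖ - l → 0 < w b → ∀ y ∈ Metric.ball b R, l < ‖y‖ ∧ 0 < w y := by
    intro b R hR hb y hy
    have hsub : ∀ y ∈ Metric.closedBall b R, l < ‖y‖ := by
      intro y hy
      have h1 : ‖b - y‖ ≤ R := by rw [← dist_eq_norm, dist_comm]; exact hy
      have h2 := norm_sub_norm_le b y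
      linarith
    exact ⟨hsub y (Metric.ball_subset_closedBall hy), ball_pos hm (hc.mono hsub) (fun y hy => hs y (hsub y hy)) (fun y hy => hw y (hsub y hy)) hb y hy⟩
  have := (isPreconnected_ext (m := m) hl).subset_of_closure_inter_subset
    (u := {y | l < ‖y‖ ∧ 0 < w y}) ?_ ⟨a, hla, hla, ha⟩ ?_
  · exact fun y hy => (this hy).2
  · rw [Metric.isOpen_iff]
    rintro b ⟨hb1, hb2⟩
    exact ⟨(‖b‖ - l)/2, by linarith, fun y hy => hball b _ (by linarith) hb2 y hy⟩
  · rintro z ⟨hz1, hz2⟩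
    have hz2 : l < ‖z‖ := hz2
    obtain ⟨b, ⟨hb1, hb2⟩, hb3⟩ := Metric.mem_closure_iff.mp hz1 ((‖z‖ - l)/4) (by linarith)
    have h2 := norm_sub_norm_le z b
    rw [← dist_eq_norm] at h2
    exact hball b ((‖z‖ - l)/2) (by linarith) hb2 z (by rw [Metric.mem_ball]; linarith)

/-- Kelvin transform -/
def kel (m : ℕ) (l : ℝ) (u : EuclideanSpace ℝ (Fin (m+2)) → ℝ) (y : EuclideanSpace ℝ (Fin (m+2))) : ℝ :=
  (l * ‖y‖⁻¹)^m * u ((l^2 * ‖y‖⁻¹^2) • y)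

/-- positive entire solutions -/
structure Sol (m : ℕ) (u : EuclideanSpace ℝ (Fin (m+2)) → ℝ) : Prop where
  cd : ContDiff ℝ 2 u
  pos : ∀ y, 0 < u y
  lap : ∀ y, laplacian u y = -(u y)^(((m:ℝ)+4)/m)

variable {u : EuclideanSpace ℝ (Fin (m+2)) → ℝ}

lemma Sol.kel_lap (hm : 1 ≤ m) (hu : Sol m u) {l : ℝ} (hl : 0 < l) {y} (hy : y ≠ 0) :
    HasLap (kel m l u) y (-(kel m l u y)^(((m:ℝ)+4)/m)) := by
  have h := (kelvin_lap u hu.cd (l^2) y hy).const_mul (l^m)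
  have hfun : (fun z => l^m * (‖z‖⁻¹ ^ m * u ((l ^ 2 * ‖z‖⁻¹ ^ 2) • z))) = kel m l u := by
    ext z; rw [kel, mul_pow]; ring
  rw [hfun, hu.lap] at h
  convert h using 1
  have hq : 0 < l * ‖y‖⁻¹ := by have := norm_pos_iff.mpr hy; positivity
  have hm' : (m:ℝ) ≠ 0 := by positivity
  rw [kel, Real.mul_rpow (by positivity) (hu.pos _).le, ← Real.rpow_natCast, ← Real.rpow_mul hq.le,
    mul_div_cancel₀ _ hm']
  have : (l * ‖y‖⁻¹)^((m:ℝ)+4) = (l * ‖y‖⁻¹)^(m+4) := by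
    rw [← Real.rpow_natCast]; push_cast; rfl
  rw [this, mul_pow]
  ring

lemma Sol.translate (hu : Sol m u) (x : EuclideanSpace ℝ (Fin (m+2))) : Sol m (fun y => u (x + y)) := by
  have hcd : ContDiff ℝ 2 (fun y => u (x + y)) := hu.cd.comp (by fun_prop)
  refine ⟨hcd, fun y => hu.pos _, fun y => ?_⟩
  rw [← hu.lap]
  exact (HasLap.of_contDiff hcd y).unique (HasLap.of_contDiff hu.cd (x + y)).comp_add

lemma continuousOn_kel (hu : Continuous u) (l : ℝ) : ContinuousOn (kel m l u) {0}ᶜ := by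
  have h : ContinuousOn (fun y : EuclideanSpace ℝ (Fin (m+2)) => ‖y‖⁻¹) {0}ᶜ :=
    continuous_norm.continuousOn.inv₀ (fun y hy => by simpa using hy)
  unfold kel
  exact ((continuousOn_const.mul h).pow m).mul
    (hu.comp_continuousOn ((continuousOn_const.mul (h.pow 2)).smul continuousOn_id))

end C

section G
variable {m : ℕ} {u : EuclideanSpace ℝ (Fin (m+2)) → ℝ}

lemma kel_eq (l : ℝ) (y : EuclideanSpace ℝ (Fin (m+2))) :
    kel m l u y = (l * ‖y‖⁻¹)^m * u ((l * ‖y‖⁻¹)^2 • y) := by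
  rw [kel, mul_pow l _ 2]

/-- radial derivative quantity -/
def Gr (m : ℕ) (u : EuclideanSpace ℝ (Fin (m+2)) → ℝ) (p : EuclideanSpace ℝ (Fin (m+2))) : ℝ :=
  m * u p + 2 * fderiv ℝ u p p

lemma continuous_Gr (hu : ContDiff ℝ 2 u) : Continuous (Gr m u) := by
  have h1 : Continuous (fderiv ℝ u) := hu.continuous_fderiv (by norm_num)
  have h2 := hu.continuous
  unfold Gr
  exact (continuous_const.mul h2).add (continuous_const.mul (h1.clm_apply continuous_id))

lemma mono_line (hm : 1 ≤ m) (hu : ContDiff ℝ 2 u) (y : EuclideanSpace ℝ (Fin (m+2))) {τ : ℝ} (h0 : 0 < τ) (h1 : τ ≤ 1)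
    (h : ∀ σ, τ ≤ σ → σ ≤ 1 → 0 ≤ Gr m u (σ^2 • y)) : τ^m * u (τ^2 • y) ≤ u y := by
  have hd : ∀ σ : ℝ, HasDerivAt (fun σ : ℝ => σ^m * u (σ^2 • y)) (σ^(m-1) * Gr m u (σ^2 • y)) σ := by
    intro σ
    have ha : HasDerivAt (fun σ : ℝ => σ^2 • y) ((2 * σ) • y) σ := by
      simpa using ((hasDerivAt_id σ).pow 2).smul_const y
    have := ((hasDerivAt_id σ).pow m).mul (((hu.differentiable (by norm_num)) (σ^2 • y)).hasFDerivAt.comp_hasDerivAt σ ha)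
    refine this.congr_deriv ?_
    obtain ⟨k, rfl⟩ : ∃ k, m = k + 1 := ⟨m - 1, by omega⟩
    simp [Gr]
    ring
  have hmono : MonotoneOn (fun σ : ℝ => σ^m * u (σ^2 • y)) (Set.Icc τ 1) := by
    apply monotoneOn_of_deriv_nonneg (convex_Icc _ _)
    · exact fun σ _ => (hd σ).continuousAt.continuousWithinAt
    · exact fun σ _ => (hd σ).differentiableAt.differentiableWithinAt
    · intro σ hσ
      rw [interior_Icc] at hσ
      rw [(hd σ).deriv]
      exact mul_nonneg (pow_nonneg (h0.trans hσ.1).le _) (h σ hσ.1.le hσ.2.le)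
  have := hmono (Set.left_mem_Icc.mpr h1) (Set.right_mem_Icc.mpr h1) h1
  simpa using this

lemma Sol.superharm (hu : Sol m u) (y) : ∃ L ≤ 0, HasLap u y L :=
  ⟨_, by rw [hu.lap]; simpa using Real.rpow_nonneg (hu.pos y).le _, HasLap.of_contDiff hu.cd y⟩

lemma step1 (hm : 1 ≤ m) (hu : Sol m u) :
    ∃ l₀ > 0, ∀ l, 0 < l → l ≤ l₀ → ∀ y, l ≤ ‖y‖ → kel m l u y ≤ u y := by
  have hcont := hu.cd.continuous
  have h0 : 0 < Gr m u 0 := by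
    have := hu.pos 0
    simp [Gr]; positivity
  obtain ⟨r', hr', hG⟩ := Metric.eventually_nhds_iff.mp ((continuous_Gr hu.cd).continuousAt.eventually (lt_mem_nhds h0))
  set r := r'/2 with hr
  have hrpos : 0 < r := by positivity
  have hne : (Metric.closedBall (0:EuclideanSpace ℝ (Fin (m+2))) r).Nonempty := ⟨0, by simp [hrpos.le]⟩
  obtain ⟨z₁, hz₁, hmin⟩ := (isCompact_closedBall (0:EuclideanSpace ℝ (Fin (m+2))) r).exists_isMinOn hne hcont.continuousOn
  obtain ⟨z₂, hz₂, hmax⟩ := (isCompact_closedBall (0:EuclideanSpace ℝ (Fin (m+2))) r).exists_isMaxOn hne hcont.continuousOn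
  have hmin' : ∀ z, ‖z‖ ≤ r → u z₁ ≤ u z := fun z hz => hmin (by simpa using hz)
  have hmax' : ∀ z, ‖z‖ ≤ r → u z ≤ u z₂ := fun z hz => hmax (by simpa using hz)
  have hc := hu.pos z₁
  have hC := hu.pos z₂
  have hcC : u z₁ ≤ u z₂ := hmin' z₂ (by simpa using hz₂)
  have hq1 : u z₁ / u z₂ ≤ 1 := (div_le_one hC).mpr hcC
  refine ⟨r * (u z₁ / u z₂), by positivity, fun l hl hll y hy => ?_⟩
  have hlr : l ≤ r := hll.trans (by nlinarith)
  have hy0 : 0 < ‖y‖ := hl.trans_le hy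
  have hτ1 : l * ‖y‖⁻¹ ≤ 1 := by rw [← div_eq_mul_inv]; exact (div_le_one hy0).mpr hy
  by_cases hyr : ‖y‖ ≤ r
  · rw [kel_eq]
    apply mono_line hm hu.cd y (by positivity) hτ1
    intro σ h1 h2
    have hσ : 0 < σ := lt_of_lt_of_le (by positivity) h1
    refine (hG ?_).le
    rw [dist_zero_right, norm_smul, Real.norm_of_nonneg (by positivity)]
    have : σ^2 ≤ 1 := by nlinarith
    nlinarith
  · push Not at hyr
    have hlow := outer_lower hm hrpos (w := u) (c := u z₁) hcont.continuousOn (fun z _ => hu.superharm z)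
      (fun z _ => (hu.pos z).le) (fun z hz => hmin' z hz.le) y hyr.le
    refine le_trans ?_ hlow
    rw [kel_eq, mul_pow]
    have h3 : u ((l * ‖y‖⁻¹)^2 • y) ≤ u z₂ := by
      apply hmax'
      rw [norm_smul, Real.norm_of_nonneg (by positivity)]
      have : (l * ‖y‖⁻¹)^2 * ‖y‖ = l * (l * ‖y‖⁻¹) := by field_simp
      rw [this]
      nlinarith
    have h4 : l^m ≤ r^m * (u z₁ / u z₂) := by
      calc l^m ≤ (r * (u z₁ / u z₂))^m := by gcongr
        _ = r^m * (u z₁ / u z₂)^m := mul_pow _ _ _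
        _ ≤ r^m * (u z₁ / u z₂) := by
          gcongr
          exact pow_le_of_le_one (by positivity) hq1 (by omega)
    calc l^m * ‖y‖⁻¹^m * u ((l * ‖y‖⁻¹)^2 • y) ≤ (r^m * (u z₁ / u z₂)) * ‖y‖⁻¹^m * u z₂ := by
          have := (hu.pos ((l * ‖y‖⁻¹)^2 • y)).le
          gcongr
      _ = _ := by field_simp

lemma Gr_pos_of_lower (hu : ContDiff ℝ 2 u) (hm : 1 ≤ m) {l B : ℝ} (hl : 0 < l) (hB : 0 < B)
    (h : ∀ y, l ≤ ‖y‖ → ‖y‖ ≤ 2 * l → B * (l⁻¹^m - ‖y‖⁻¹^m) ≤ u y - kel m l u y)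
    (p : EuclideanSpace ℝ (Fin (m+2))) (hp : ‖p‖ = l) : 0 < Gr m u p := by
  set H : ℝ → ℝ := fun s => u (s • p) - (s⁻¹)^m * u (s⁻¹ • p) - B * l⁻¹^m * (1 - s⁻¹^m) with hH
  have hdu := (hu.differentiable (by norm_num)) p
  have hinv : HasDerivAt (fun s : ℝ => s⁻¹) (-1) 1 := by simpa using hasDerivAt_inv (one_ne_zero (α := ℝ))
  have hip : HasDerivAt (fun s : ℝ => s⁻¹^m) (-m) 1 := (hinv.pow m).congr_deriv (by simp)
  have h1 : HasDerivAt (fun s : ℝ => u (s • p)) (fderiv ℝ u p p) 1 := by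
    have ha : HasDerivAt (fun s : ℝ => s • p) p 1 := by simpa using (hasDerivAt_id (1:ℝ)).smul_const p
    refine HasFDerivAt.comp_hasDerivAt (f := fun s : ℝ => s • p) (l := u) 1 ?_ ha
    simpa using hdu.hasFDerivAt
  have h2 : HasDerivAt (fun s : ℝ => u (s⁻¹ • p)) (-fderiv ℝ u p p) 1 := by
    have ha : HasDerivAt (fun s : ℝ => s⁻¹ • p) (-p) 1 := by simpa using hinv.smul_const p
    rw [← map_neg]
    refine HasFDerivAt.comp_hasDerivAt (f := fun s : ℝ => s⁻¹ • p) (l := u) 1 ?_ ha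
    simpa using hdu.hasFDerivAt
  have hHd : HasDerivAt H (Gr m u p - m * (B * l⁻¹^m)) 1 := by
    have := (h1.sub (hip.mul h2)).sub ((hip.const_sub 1).const_mul (B * l⁻¹^m))
    refine this.congr_deriv ?_
    simp [Gr]; ring
  have hH1 : H 1 = 0 := by simp [hH]
  have hHnn : ∀ s ∈ Set.Ioo (1:ℝ) 2, 0 ≤ H s := by
    intro s hs
    have hs0 : 0 < s := by linarith [hs.1]
    have hn : ‖s • p‖ = s * l := by rw [norm_smul, hp, Real.norm_of_nonneg hs0.le]
    have := h (s • p) (by rw [hn]; nlinarith [hs.1]) (by rw [hn]; nlinarith [hs.2])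
    rw [kel_eq, hn] at this
    have e1 : l * (s * l)⁻¹ = s⁻¹ := by field_simp
    have e2 : (s⁻¹)^2 • s • p = s⁻¹ • p := by
      rw [smul_smul]; congr 1; field_simp
    rw [e1, e2, mul_inv, mul_pow] at this
    simp only [hH]
    linarith
  have hnn : 0 ≤ Gr m u p - m * (B * l⁻¹^m) := by
    have ht := (hasDerivAt_iff_tendsto_slope.mp hHd).mono_left (nhdsWithin_mono 1 (fun x (hx : x ∈ Set.Ioi (1:ℝ)) => (ne_of_gt hx : x ≠ 1)))
    refine ge_of_tendsto ht ?_
    filter_upwards [Ioo_mem_nhdsGT (by norm_num : (1:ℝ) < 2)] with s hs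
    rw [slope_def_field, hH1, sub_zero]
    exact div_nonneg (hHnn s hs) (by linarith [hs.1])
  have hm' : (0:ℝ) < m := by exact_mod_cast hm
  have : 0 < m * (B * l⁻¹^m) := by positivity
  linarith

end G

section G
variable {m : ℕ} {u : EuclideanSpace ℝ (Fin (m+2)) → ℝ}

/-- lower bounds for the difference -/
lemma diff_lower (hm : 1 ≤ m) (hu : Sol m u) {l : ℝ} (hl : 0 < l)
    (hP : ∀ y, l ≤ ‖y‖ → kel m l u y ≤ u y) (a : EuclideanSpace ℝ (Fin (m+2))) (hla : l < ‖a‖)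
    (ha : kel m l u a < u a) :
    (∀ y, l < ‖y‖ → kel m l u y < u y) ∧
    (∃ κ > 0, ∀ y, 2 * l ≤ ‖y‖ → kel m l u y + κ * ‖y‖⁻¹^m ≤ u y) ∧
    (∀ p, ‖p‖ = l → 0 < Gr m u p) := by
  set w : EuclideanSpace ℝ (Fin (m+2)) → ℝ := fun y => u y - kel m l u y with hw
  have hwc : ContinuousOn w {0}ᶜ := hu.cd.continuous.continuousOn.sub (continuousOn_kel hu.cd.continuous l)
  have hsub : ∀ r : ℝ, 0 < r → {y : EuclideanSpace ℝ (Fin (m+2)) | r ≤ ‖y‖} ⊆ {0}ᶜ := by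
    intro r hr y hy h0
    have : y = 0 := h0
    have hy : r ≤ ‖y‖ := hy
    rw [this, norm_zero] at hy; linarith
  have hs : ∀ y, l ≤ ‖y‖ → ∃ L ≤ 0, HasLap w y L := by
    intro y hy
    have hy0 : y ≠ 0 := hsub l hl hy
    refine ⟨_, ?_, (HasLap.of_contDiff hu.cd y).sub (hu.kel_lap hm hl hy0)⟩
    rw [hu.lap]
    have hk : 0 ≤ kel m l u y := by
      unfold kel
      exact mul_nonneg (by positivity) (hu.pos _).le
    have := Real.rpow_le_rpow hk (hP y hy) (by positivity : 0 ≤ ((m:ℝ)+4)/m)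
    linarith
  have hw0 : ∀ y, l ≤ ‖y‖ → 0 ≤ w y := fun y hy => sub_nonneg.mpr (hP y hy)
  have hpos := strong_pos hm hl.le (hwc.mono (fun y (hy : l < ‖y‖) => hsub l hl (show l ≤ ‖y‖ from hy.le)))
    (fun y hy => hs y hy.le) (fun y hy => hw0 y hy.le) a hla (sub_pos.mpr ha)
  have h2l : 0 < 2 * l := by linarith
  obtain ⟨z₁, hz₁, hmin⟩ := (isCompact_sphere (0:EuclideanSpace ℝ (Fin (m+2))) (2*l)).exists_isMinOn
    (NormedSpace.sphere_nonempty.mpr h2l.le) (hwc.mono (fun y hy => hsub (2*l) h2l (by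
      have : ‖y‖ = 2 * l := by simpa using hy
      exact this.ge)))
  have hz₁' : ‖z₁‖ = 2 * l := by simpa using hz₁
  have hmin' : ∀ z, ‖z‖ = 2 * l → w z₁ ≤ w z := fun z hz => hmin (by simpa using hz)
  have hc : 0 < w z₁ := hpos z₁ (by linarith)
  refine ⟨fun y hy => sub_pos.mp (hpos y hy), ⟨w z₁ * (2*l)^m, by positivity, fun y hy => ?_⟩, ?_⟩
  · have := outer_lower hm h2l (w := w) (c := w z₁) (hwc.mono (hsub _ h2l)) (fun z hz => hs z (by linarith))
      (fun z hz => hw0 z (by linarith)) hmin' y hy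
    simp only [hw] at this ⊢
    linarith
  · have hlt : (2*l)⁻¹^m < l⁻¹^m := by
      apply pow_lt_pow_left₀ _ (by positivity) (by omega)
      exact inv_strictAnti₀ hl (by linarith)
    set B := w z₁ / (l⁻¹^m - (2*l)⁻¹^m) with hB
    have hBpos : 0 < B := div_pos hc (by linarith)
    have hmul : B * (l⁻¹^m - (2*l)⁻¹^m) = w z₁ := div_mul_cancel₀ _ (by linarith)
    refine Gr_pos_of_lower hu.cd hm hl hBpos fun y hy1 hy2 => ?_
    have := annulus_compare (m := m) 0 (r₁ := l) (r₂ := 2*l) (A := B * l⁻¹^m) (B := -B) hl (w := w)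
      (hwc.mono fun z hz => hsub l hl (by simpa using hz.1)) (fun z h _ => hs z (by simpa using h.le)) ?_ ?_ y
      (by simpa using hy1) (by simpa using hy2)
    · simp only [sub_zero] at this; simp only [hw] at this; linarith
    · intro z hz
      have := hw0 z (by simpa using hz.ge)
      linarith
    · intro z hz
      have := hmin' z (by simpa using hz)
      linarith

lemma step2 (hm : 1 ≤ m) (hu : Sol m u) {l : ℝ} (hl : 0 < l)
    (hP : ∀ y, l ≤ ‖y‖ → kel m l u y ≤ u y) (a : EuclideanSpace ℝ (Fin (m+2))) (hla : l < ‖a‖)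
    (ha : kel m l u a < u a) :
    ∃ δ > 0, ∀ l', l ≤ l' → l' ≤ l + δ → ∀ y, l' ≤ ‖y‖ → kel m l' u y ≤ u y := by
  obtain ⟨hpos, ⟨κ, hκ, hκw⟩, hGr⟩ := diff_lower hm hu hl hP a hla ha
  have hcont := hu.cd.continuous
  by_contra! hcon
  have hseq : ∀ n : ℕ, ∃ q : ℝ × EuclideanSpace ℝ (Fin (m+2)), l ≤ q.1 ∧ q.1 ≤ l + 1/((n:ℝ)+1) ∧ q.1 ≤ ‖q.2‖ ∧
      u q.2 < kel m q.1 u q.2 := by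
    intro n
    obtain ⟨l', h1, h2, y, h3, h4⟩ := hcon (1/((n:ℝ)+1)) (by positivity)
    exact ⟨(l', y), h1, h2, h3, h4⟩
  choose q hq1 hq2 hq3 hq4 using hseq
  set L : ℕ → ℝ := fun n => (q n).1 with hL
  set Y : ℕ → EuclideanSpace ℝ (Fin (m+2)) := fun n => (q n).2 with hY
  have hLpos : ∀ n, 0 < L n := fun n => hl.trans_le (hq1 n)
  have hYpos : ∀ n, 0 < ‖Y n‖ := fun n => (hLpos n).trans_le (hq3 n)
  have hLlim : Tendsto L atTop (𝓝 l) := by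
    refine tendsto_of_tendsto_of_tendsto_of_le_of_le tendsto_const_nhds (h := fun n : ℕ => l + 1/((n:ℝ)+1)) ?_ hq1 hq2
    simpa using (tendsto_one_div_add_atTop_nhds_zero_nat (𝕜 := ℝ)).const_add l
  set X : ℕ → ℝ × EuclideanSpace ℝ (Fin (m+2)) := fun n => (L n * ‖Y n‖⁻¹, ‖Y n‖⁻¹ • Y n) with hX
  have hXmem : ∀ n, X n ∈ (Set.Icc (0:ℝ) 1) ×ˢ (Metric.sphere (0:EuclideanSpace ℝ (Fin (m+2))) 1) := by
    intro n
    refine ⟨⟨?_, ?_⟩, ?_⟩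
    · have := hLpos n; simp only [hX]; positivity
    · simp only [hX]; rw [← div_eq_mul_inv]; exact (div_le_one (hYpos n)).mpr (hq3 n)
    · simp only [hX]
      rw [mem_sphere_zero_iff_norm, norm_smul, norm_inv, norm_norm]
      exact inv_mul_cancel₀ (hYpos n).ne'
  obtain ⟨⟨τ, θ⟩, ⟨hτm, hθm⟩, φ, hφ, hlim⟩ := (isCompact_Icc.prod (isCompact_sphere _ _)).tendsto_subseq hXmem
  have hτ : 0 ≤ τ ∧ τ ≤ 1 := hτm
  have hθ : ‖θ‖ = 1 := by simpa using hθm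
  clear hτm hθm
  -- subsequence data
  set Lk : ℕ → ℝ := fun n => L (φ n) with hLk
  set T : ℕ → ℝ := fun n => (X (φ n)).1 with hT
  set Θ : ℕ → EuclideanSpace ℝ (Fin (m+2)) := fun n => (X (φ n)).2 with hΘ
  have tT : Tendsto T atTop (𝓝 τ) := (continuous_fst.tendsto _).comp hlim
  have tΘ : Tendsto Θ atTop (𝓝 θ) := (continuous_snd.tendsto _).comp hlim
  have tL : Tendsto Lk atTop (𝓝 l) := hLlim.comp hφ.tendsto_atTop
  have hTpos : ∀ n, 0 < T n := fun n => by
    have := hLpos (φ n); have := hYpos (φ n); simp only [hT, hX]; positivity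
  have hT1 : ∀ n, T n ≤ 1 := fun n => (hXmem (φ n)).1.2
  have hnorm : ∀ n, ‖Y (φ n)‖ = Lk n * (T n)⁻¹ := by
    intro n
    have := (hYpos (φ n)).ne'
    have := (hLpos (φ n)).ne'
    simp only [hT, hX, hLk]; field_simp
  have hYe : ∀ n, Y (φ n) = (Lk n * (T n)⁻¹) • Θ n := by
    intro n
    rw [← hnorm]; simp only [hΘ, hX]; rw [smul_smul, mul_inv_cancel₀ (hYpos (φ n)).ne', one_smul]
  have hlt : ∀ n, u (Y (φ n)) < (T n)^m * u ((T n)^2 • Y (φ n)) := by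
    intro n
    have := hq4 (φ n)
    rwa [kel_eq] at this
  have hTY : ∀ n, (T n)^2 • Y (φ n) = (Lk n * T n) • Θ n := by
    intro n
    rw [hYe, smul_smul]; congr 1
    have := (hTpos n).ne'
    field_simp
  rcases hτ.1.eq_or_lt with h0 | h0
  · -- escape to infinity
    subst h0
    have hev : ∀ᶠ n in atTop, 2 * l ≤ ‖Y (φ n)‖ := by
      have : ∀ᶠ n in atTop, T n < 1/2 := tT.eventually (gt_mem_nhds (by norm_num))
      filter_upwards [this] with n hn
      rw [hnorm, ← div_eq_mul_inv, le_div_iff₀ (hTpos n)]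
      have : l ≤ Lk n := hq1 (φ n)
      nlinarith [hTpos n]
    have hineq : ∀ᶠ n in atTop, (l * (Lk n)⁻¹)^m * u ((l^2 * (Lk n)⁻¹ * T n) • Θ n) + κ * (Lk n)⁻¹^m ≤ u ((Lk n * T n) • Θ n) := by
      filter_upwards [hev] with n hn
      have h1 := (hκw _ hn).trans (hlt n).le
      rw [hTY, kel, hnorm] at h1
      have hLn : 0 < Lk n := hLpos (φ n)
      have e1 : (Lk n * (T n)⁻¹)⁻¹ = T n * (Lk n)⁻¹ := by rw [mul_inv, inv_inv, mul_comm]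
      have e2 : (l^2 * (Lk n * (T n)⁻¹)⁻¹^2) • Y (φ n) = (l^2 * (Lk n)⁻¹ * T n) • Θ n := by
        rw [hYe, smul_smul]; congr 1
        have := (hTpos n).ne'
        field_simp
      rw [e2, e1] at h1
      have hTm : 0 < (T n)^m := pow_pos (hTpos n) m
      have h2 : (T n)^m * ((l * (Lk n)⁻¹)^m * u ((l^2 * (Lk n)⁻¹ * T n) • Θ n) + κ * (Lk n)⁻¹^m) ≤ (T n)^m * u ((Lk n * T n) • Θ n) := by
        refine le_trans (le_of_eq ?_) h1
        simp only [mul_pow]; ring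
      exact le_of_mul_le_mul_left h2 hTm
    have tLi : Tendsto (fun n => (Lk n)⁻¹) atTop (𝓝 l⁻¹) := tL.inv₀ hl.ne'
    have t1 : Tendsto (fun n => (l * (Lk n)⁻¹)^m * u ((l^2 * (Lk n)⁻¹ * T n) • Θ n) + κ * (Lk n)⁻¹^m) atTop
        (𝓝 ((l * l⁻¹)^m * u ((l^2 * l⁻¹ * 0) • θ) + κ * l⁻¹^m)) :=
      (((tLi.const_mul l).pow m).mul ((hcont.tendsto _).comp (((tLi.const_mul (l^2)).mul tT).smul tΘ))).add
        ((tLi.pow m).const_mul κ)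
    have t2 : Tendsto (fun n => u ((Lk n * T n) • Θ n)) atTop (𝓝 (u ((l * 0) • θ))) :=
      (hcont.tendsto _).comp ((tL.mul tT).smul tΘ)
    have := le_of_tendsto_of_tendsto t1 t2 hineq
    rw [mul_inv_cancel₀ hl.ne'] at this
    simp only [mul_zero, zero_smul, one_pow, one_mul] at this
    have : 0 < κ * l⁻¹^m := by positivity
    linarith
  have tY : Tendsto (fun n => Y (φ n)) atTop (𝓝 ((l * τ⁻¹) • θ)) := by
    simp_rw [hYe]
    exact (tL.mul (tT.inv₀ h0.ne')).smul tΘ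
  rcases hτ.2.eq_or_lt with h1 | h1
  · -- boundary
    subst h1
    rw [inv_one, mul_one] at tY
    have hp : ‖l • θ‖ = l := by rw [norm_smul, hθ, mul_one, Real.norm_of_nonneg hl.le]
    obtain ⟨ρ, hρ, hG⟩ := Metric.eventually_nhds_iff.mp ((continuous_Gr hu.cd).continuousAt.eventually (lt_mem_nhds (hGr _ hp)))
    have ev1 : ∀ᶠ n in atTop, dist (Y (φ n)) (l • θ) < ρ/2 := tY.eventually (Metric.ball_mem_nhds _ (by positivity))
    have ev2 : ∀ᶠ n in atTop, (1 - (T n)^2) * ‖Y (φ n)‖ < ρ/2 := by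
      have : Tendsto (fun n => (1 - (T n)^2) * ‖Y (φ n)‖) atTop (𝓝 ((1 - 1^2) * ‖l • θ‖)) :=
        ((tT.pow 2).const_sub 1).mul tY.norm
      refine this.eventually (gt_mem_nhds ?_)
      simp; positivity
    obtain ⟨n, hn1, hn2⟩ := (ev1.and ev2).exists
    have := mono_line hm hu.cd (Y (φ n)) (hTpos n) (hT1 n) (fun σ hσ1 hσ2 => ?_)
    · linarith [hlt n]
    · refine (hG ?_).le
      have hσ0 : 0 < σ := (hTpos n).trans_le hσ1
      have hd : dist (σ^2 • Y (φ n)) (Y (φ n)) ≤ (1 - (T n)^2) * ‖Y (φ n)‖ := by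
        rw [dist_eq_norm]
        have : σ^2 • Y (φ n) - Y (φ n) = (-(1 - σ^2)) • Y (φ n) := by module
        rw [this, norm_smul, norm_neg, Real.norm_of_nonneg (by nlinarith)]
        apply mul_le_mul_of_nonneg_right _ (norm_nonneg _)
        nlinarith [hTpos n]
      have := dist_triangle (σ^2 • Y (φ n)) (Y (φ n)) (l • θ)
      linarith
  · -- interior
    have t1 : Tendsto (fun n => u (Y (φ n))) atTop (𝓝 (u ((l * τ⁻¹) • θ))) := (hcont.tendsto _).comp tY
    have t2 : Tendsto (fun n => (T n)^m * u ((T n)^2 • Y (φ n))) atTop (𝓝 (τ^m * u (τ^2 • (l * τ⁻¹) • θ))) :=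
      (tT.pow m).mul ((hcont.tendsto _).comp ((tT.pow 2).smul tY))
    have hle := le_of_tendsto_of_tendsto' t1 t2 (fun n => (hlt n).le)
    have hn : ‖(l * τ⁻¹) • θ‖ = l * τ⁻¹ := by rw [norm_smul, hθ, mul_one, Real.norm_of_nonneg (by positivity)]
    have := hpos ((l * τ⁻¹) • θ) (by
      rw [hn, ← div_eq_mul_inv, lt_div_iff₀ h0]; nlinarith)
    rw [kel_eq, hn] at this
    have e : l * (l * τ⁻¹)⁻¹ = τ := by field_simp
    rw [e] at this
    linarith

lemma kel_involution {l : ℝ} (hl : 0 < l)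
    (h : ∀ y, l < ‖y‖ → kel m l u y = u y) : ∀ y, y ≠ 0 → kel m l u y = u y := by
  intro y hy
  have hy0 := norm_pos_iff.mpr hy
  rcases lt_trichotomy l ‖y‖ with h1 | h1 | h1
  · exact h y h1
  · rw [kel_eq, ← h1, mul_inv_cancel₀ hl.ne']; simp
  · set z := (l^2 * ‖y‖⁻¹^2) • y with hz
    have hn : ‖z‖ = l^2 * ‖y‖⁻¹ := by
      rw [hz, norm_smul, Real.norm_of_nonneg (by positivity)]; field_simp
    have hlz : l < ‖z‖ := by
      rw [hn, ← div_eq_mul_inv, lt_div_iff₀ hy0]; nlinarith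
    have := h z hlz
    rw [kel, hn] at this
    have e : (l^2 * (l^2 * ‖y‖⁻¹)⁻¹^2) • z = y := by
      rw [hz, smul_smul]
      have : l^2 * (l^2 * ‖y‖⁻¹)⁻¹^2 * (l^2 * ‖y‖⁻¹^2) = 1 := by field_simp
      rw [this, one_smul]
    rw [e] at this
    rw [kel, ← hz, ← this, ← mul_assoc, ← mul_pow]
    have e2 : l * ‖y‖⁻¹ * (l * (l^2 * ‖y‖⁻¹)⁻¹) = 1 := by field_simp
    rw [e2]; simp

lemma dichotomy (hm : 1 ≤ m) (hu : Sol m u) :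
    (∀ l, 0 < l → ∀ y, l ≤ ‖y‖ → kel m l u y ≤ u y) ∨
    (∃ l, 0 < l ∧ ∀ y, y ≠ 0 → kel m l u y = u y) := by
  obtain ⟨l₀, hl₀, h₀⟩ := step1 hm hu
  set S : Set ℝ := {s | 0 < s ∧ ∀ l, 0 < l → l ≤ s → ∀ y, l ≤ ‖y‖ → kel m l u y ≤ u y} with hS
  have hS0 : l₀ ∈ S := ⟨hl₀, h₀⟩
  by_cases hb : BddAbove S
  · right
    set Λ := sSup S with hΛ
    have hΛ0 : l₀ ≤ Λ := le_csSup hb hS0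
    have hΛpos : 0 < Λ := by linarith
    have hlt : ∀ l, 0 < l → l < Λ → ∀ y, l ≤ ‖y‖ → kel m l u y ≤ u y := by
      intro l hl hlΛ
      obtain ⟨s, hs, hls⟩ := exists_lt_of_lt_csSup ⟨l₀, hS0⟩ hlΛ
      exact hs.2 l hl hls.le
    have hPΛ : ∀ y, Λ ≤ ‖y‖ → kel m Λ u y ≤ u y := by
      intro y hy
      have hc : Continuous fun l => kel m l u y := by
        have := hu.cd.continuous
        unfold kel
        fun_prop
      have ht : Tendsto (fun l => kel m l u y) (𝓝[<] Λ) (𝓝 (kel m Λ u y)) := (hc.tendsto Λ).mono_left nhdsWithin_le_nhds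
      refine le_of_tendsto ht ?_
      filter_upwards [Ioo_mem_nhdsLT hΛpos] with l hl
      exact hlt l hl.1 hl.2 y (hl.2.le.trans hy)
    refine ⟨Λ, hΛpos, kel_involution hΛpos fun y hy => ?_⟩
    by_contra hne
    obtain ⟨δ, hδ, hd⟩ := step2 hm hu hΛpos hPΛ y hy (lt_of_le_of_ne (hPΛ y hy.le) hne)
    have : Λ + δ ∈ S := by
      refine ⟨by linarith, fun l hl hlΛ => ?_⟩
      rcases lt_or_ge l Λ with h | h
      · exact hlt l hl h
      · exact hd l h hlΛ
    have := le_csSup hb this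
    linarith
  · left
    intro l hl
    rw [not_bddAbove_iff] at hb
    obtain ⟨s, hs, hls⟩ := hb l
    exact hs.2 l hl hls.le

end G

section H
variable {m : ℕ} {u : EuclideanSpace ℝ (Fin (m+2)) → ℝ}

/-- Rescaled profile at infinity, in terms of `v = u ^ (-2/m)`. -/
def QQ (v : EuclideanSpace ℝ (Fin (m+2)) → ℝ) (x : EuclideanSpace ℝ (Fin (m+2))) (l : ℝ)
    (h : EuclideanSpace ℝ (Fin (m+2))) (t : ℝ) : ℝ :=
  l⁻¹^2 * ‖h - t • x‖^2 * v (x + (l^2 * t * ‖h - t • x‖⁻¹^2) • (h - t • x))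

lemma QQ_zero (v : EuclideanSpace ℝ (Fin (m+2)) → ℝ) (x h) (l : ℝ) :
    QQ v x l h 0 = l⁻¹^2 * ‖h‖^2 * v x := by
  simp [QQ]

lemma QQ_deriv {v : EuclideanSpace ℝ (Fin (m+2)) → ℝ} (hv : Differentiable ℝ v)
    (x h : EuclideanSpace ℝ (Fin (m+2))) (hh : h ≠ 0) {l : ℝ} (hl : 0 < l) :
    HasDerivAt (QQ v x l h) (l⁻¹^2 * v x * (-2 * inner ℝ h x) + fderiv ℝ v x h) 0 := by
  have hh0 : ‖h‖ ≠ 0 := norm_ne_zero_iff.mpr hh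
  have hq : HasDerivAt (fun t : ℝ => h - t • x) (-x) 0 := by
    have := ((hasDerivAt_id (0:ℝ)).smul_const x).const_sub h
    simpa using this
  have hn : HasDerivAt (fun t : ℝ => ‖h - t • x‖^2) (-2 * inner ℝ h x) 0 := by
    have := hq.norm_sq
    refine this.congr_deriv ?_
    simp
  have hinv : HasDerivAt (fun t : ℝ => ‖h - t • x‖⁻¹^2) (-(-2 * inner ℝ h x) / (‖h‖^2)^2) 0 := by
    have := hn.inv (by simpa using hh0)
    simp only [zero_smul, sub_zero] at this
    refine this.congr_of_eventuallyEq (Eventually.of_forall fun t => ?_)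
    simp [inv_pow]
  have hc : HasDerivAt (fun t : ℝ => l^2 * t * ‖h - t • x‖⁻¹^2) (l^2 * ‖h‖⁻¹^2) 0 := by
    have := ((hasDerivAt_id (0:ℝ)).const_mul (l^2)).mul hinv
    refine this.congr_deriv ?_
    simp
  have hγ : HasDerivAt (fun t : ℝ => x + (l^2 * t * ‖h - t • x‖⁻¹^2) • (h - t • x)) ((l^2 * ‖h‖⁻¹^2) • h) 0 := by
    have := (hc.smul hq).const_add x
    refine this.congr_deriv ?_
    simp
  have hγ0 : x + (l^2 * 0 * ‖h - (0:ℝ) • x‖⁻¹^2) • (h - (0:ℝ) • x) = x := by simp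
  have hvx : HasFDerivAt v (fderiv ℝ v x) (x + (l^2 * 0 * ‖h - (0:ℝ) • x‖⁻¹^2) • (h - (0:ℝ) • x)) := by
    rw [hγ0]; exact (hv x).hasFDerivAt
  have hcomp := hvx.comp_hasDerivAt (0:ℝ) hγ
  have := (hn.const_mul (l⁻¹^2)).mul hcomp
  unfold QQ
  refine this.congr_deriv ?_
  rw [Function.comp_apply, hγ0]
  simp only [map_smul, smul_eq_mul, zero_smul, sub_zero]
  field_simp

lemma rpow_aux (hm : 1 ≤ m) {a b : ℝ} (ha : 0 < a) (hb : 0 < b) :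
    (a^m * b)^(-(2/(m:ℝ))) = a⁻¹^2 * b^(-(2/(m:ℝ))) := by
  have hm0 : (m:ℝ) ≠ 0 := by positivity
  rw [Real.mul_rpow (by positivity) hb.le, ← Real.rpow_natCast a m, ← Real.rpow_mul ha.le]
  have : (m:ℝ) * -(2/(m:ℝ)) = -((2:ℕ):ℝ) := by push_cast; field_simp
  rw [this, Real.rpow_neg ha.le, Real.rpow_natCast, inv_pow]

lemma kel_QQ (hm : 1 ≤ m) (hpos : ∀ y, 0 < u y) (x h : EuclideanSpace ℝ (Fin (m+2))) {l t : ℝ} (hl : 0 < l)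
    (ht : 0 < t) (hq : h - t • x ≠ 0) :
    t^2 * (kel m l (fun y => u (x + y)) (t⁻¹ • h - x))^(-(2/(m:ℝ))) =
      QQ (fun z => (u z)^(-(2/(m:ℝ)))) x l h t := by
  have hq0 : 0 < ‖h - t • x‖ := norm_pos_iff.mpr hq
  have e : t⁻¹ • h - x = t⁻¹ • (h - t • x) := by
    rw [smul_sub, smul_smul, inv_mul_cancel₀ ht.ne', one_smul]
  rw [e, kel, norm_smul, norm_inv, Real.norm_of_nonneg ht.le, QQ]
  have e2 : (l^2 * (t⁻¹ * ‖h - t • x‖)⁻¹^2) • t⁻¹ • (h - t • x) = (l^2 * t * ‖h - t • x‖⁻¹^2) • (h - t • x) := by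
    rw [smul_smul]; congr 1; field_simp
  rw [e2, rpow_aux hm (by positivity) (hpos _)]
  field_simp

lemma ev_ne (x h : EuclideanSpace ℝ (Fin (m+2))) (hh : h ≠ 0) :
    ∀ᶠ t : ℝ in 𝓝 0, h - t • x ≠ 0 := by
  have : ContinuousAt (fun t : ℝ => h - t • x) 0 := by fun_prop
  exact this.eventually_ne (by simpa using hh)

lemma ev_large (x h : EuclideanSpace ℝ (Fin (m+2))) (hh : h ≠ 0) (l : ℝ) :
    ∀ᶠ t : ℝ in 𝓝[>] 0, l ≤ ‖t⁻¹ • h - x‖ := by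
  have h1 : Tendsto (fun t : ℝ => t⁻¹ * ‖h‖) (𝓝[>] 0) atTop :=
    tendsto_inv_nhdsGT_zero.atTop_mul_const (norm_pos_iff.mpr hh)
  filter_upwards [h1.eventually_ge_atTop (l + ‖x‖), self_mem_nhdsWithin] with t ht ht0
  have h2 := norm_sub_norm_le (t⁻¹ • h) x
  rw [norm_smul, norm_inv, Real.norm_of_nonneg (le_of_lt ht0)] at h2
  linarith

lemma caseB_QQ (hm : 1 ≤ m) (hpos : ∀ y, 0 < u y) (x h : EuclideanSpace ℝ (Fin (m+2))) (hh : h ≠ 0) {l : ℝ} (hl : 0 < l)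
    (hB : ∀ y, y ≠ 0 → kel m l (fun y => u (x + y)) y = u (x + y)) :
    ∀ᶠ t : ℝ in 𝓝[>] 0, t^2 * (u (t⁻¹ • h))^(-(2/(m:ℝ))) = QQ (fun z => (u z)^(-(2/(m:ℝ)))) x l h t := by
  filter_upwards [(ev_ne x h hh).filter_mono nhdsWithin_le_nhds, ev_large x h hh 1, self_mem_nhdsWithin] with t h1 h2 h3
  rw [← kel_QQ hm hpos x h hl h3 h1, hB]
  · simp
  · intro h0; rw [h0, norm_zero] at h2; linarith

lemma caseA_QQ (hm : 1 ≤ m) (hpos : ∀ y, 0 < u y) (x h : EuclideanSpace ℝ (Fin (m+2))) (hh : h ≠ 0) {l : ℝ} (hl : 0 < l)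
    (hA : ∀ y, l ≤ ‖y‖ → kel m l (fun y => u (x + y)) y ≤ u (x + y)) :
    ∀ᶠ t : ℝ in 𝓝[>] 0, t^2 * (u (t⁻¹ • h))^(-(2/(m:ℝ))) ≤ QQ (fun z => (u z)^(-(2/(m:ℝ)))) x l h t := by
  filter_upwards [(ev_ne x h hh).filter_mono nhdsWithin_le_nhds, ev_large x h hh l, self_mem_nhdsWithin] with t h1 h2 h3
  rw [← kel_QQ hm hpos x h hl h3 h1]
  have h4 := hA _ h2
  simp only [add_sub_cancel] at h4
  have hy : 0 < ‖t⁻¹ • h - x‖ := hl.trans_le h2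
  have hk : 0 < kel m l (fun y => u (x + y)) (t⁻¹ • h - x) := by
    unfold kel
    exact mul_pos (by positivity) (hpos _)
  apply mul_le_mul_of_nonneg_left _ (by positivity)
  exact Real.rpow_le_rpow_of_nonpos hk h4 (by
    have : 0 ≤ 2/(m:ℝ) := by positivity
    linarith)

lemma v_diff (hu : Sol m u) : Differentiable ℝ (fun z => (u z)^(-(2/(m:ℝ)))) := by
  have h1 : Differentiable ℝ u := hu.cd.differentiable (by norm_num)
  exact h1.rpow_const (fun x => Or.inl (hu.pos x).ne')

lemma allA_false (hu : Sol m u) (hdecay : Tendsto u (cocompact (EuclideanSpace ℝ (Fin (m+2)))) (𝓝 0))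
    (hA : ∀ x, ∀ l, 0 < l → ∀ y, l ≤ ‖y‖ → kel m l (fun y => u (x + y)) y ≤ u (x + y)) : False := by
  have key : ∀ y : EuclideanSpace ℝ (Fin (m+2)), y ≠ 0 → (√2/2)^m * u 0 ≤ u y := by
    intro y hy
    have hy0 := norm_pos_iff.mpr hy
    have h2 : √2 ≤ 2 := by
      rw [Real.sqrt_le_left (by norm_num)]; norm_num
    have hn : ‖(2:ℝ) • y‖ = 2 * ‖y‖ := by rw [norm_smul]; simp
    have := hA (-y) (√2 * ‖y‖) (by positivity) ((2:ℝ) • y) (by rw [hn]; nlinarith)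
    rw [kel_eq, hn] at this
    have e1 : √2 * ‖y‖ * (2 * ‖y‖)⁻¹ = √2/2 := by field_simp
    have e2 : (√2/2)^2 = 1/2 := by rw [div_pow, Real.sq_sqrt (by norm_num)]; norm_num
    rw [e1, e2, smul_smul] at this
    have e3 : -y + (1/2 * 2 : ℝ) • y = 0 := by norm_num
    have e4 : -y + (2:ℝ) • y = y := by module
    simpa only [e3, e4] using this
  have h0 : ∀ᶠ y in cocompact (EuclideanSpace ℝ (Fin (m+2))), (√2/2)^m * u 0 ≤ u y := by
    filter_upwards [(isCompact_singleton (x := (0 : EuclideanSpace ℝ (Fin (m+2))))).compl_mem_cocompact] with y hy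
    exact key y hy
  have := ge_of_tendsto hdecay h0
  have h1 := hu.pos 0
  have : 0 < (√2/2)^m * u 0 := by positivity
  linarith

lemma allB (hm : 1 ≤ m) (hu : Sol m u) (hdecay : Tendsto u (cocompact (EuclideanSpace ℝ (Fin (m+2)))) (𝓝 0)) :
    ∀ x, ∃ l, 0 < l ∧ ∀ y, y ≠ 0 → kel m l (fun y => u (x + y)) y = u (x + y) := by
  by_contra hcon
  obtain ⟨x, hx⟩ := not_forall.mp hcon
  have hAx := (dichotomy hm (hu.translate x)).resolve_right hx
  apply allA_false hu hdecay
  intro x'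
  rcases dichotomy hm (hu.translate x') with h | ⟨l', hl', hB⟩
  · exact h
  exfalso
  set h : EuclideanSpace ℝ (Fin (m+2)) := eb 0 with hhdef
  have hn : ‖h‖ = 1 := by simp [hhdef]
  have hh : h ≠ 0 := norm_ne_zero_iff.mp (by rw [hn]; norm_num)
  set v : EuclideanSpace ℝ (Fin (m+2)) → ℝ := fun z => (u z)^(-(2/(m:ℝ))) with hv
  have hvp : ∀ z, 0 < v z := fun z => Real.rpow_pos_of_pos (hu.pos z) _
  have t1 : Tendsto (QQ v x' l' h) (𝓝[>] 0) (𝓝 (l'⁻¹^2 * v x')) := by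
    have := (QQ_deriv (v_diff hu) x' h hh hl').continuousAt.tendsto
    rw [QQ_zero, hn] at this
    simpa using this.mono_left nhdsWithin_le_nhds
  have key : ∀ l, 0 < l → l'⁻¹^2 * v x' ≤ l⁻¹^2 * v x := by
    intro l hl
    have t2 : Tendsto (QQ v x l h) (𝓝[>] 0) (𝓝 (l⁻¹^2 * v x)) := by
      have := (QQ_deriv (v_diff hu) x h hh hl).continuousAt.tendsto
      rw [QQ_zero, hn] at this
      simpa using this.mono_left nhdsWithin_le_nhds
    refine le_of_tendsto_of_tendsto t1 t2 ?_
    filter_upwards [caseB_QQ hm hu.pos x' h hh hl' hB, caseA_QQ hm hu.pos x h hh hl (hAx l hl)] with t e1 e2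
    rw [← e1]; exact e2
  have t3 : Tendsto (fun l : ℝ => l⁻¹^2 * v x) atTop (𝓝 (0^2 * v x)) :=
    (tendsto_inv_atTop_zero.pow 2).mul_const _
  have := ge_of_tendsto t3 ((eventually_gt_atTop 0).mono key)
  have h3 := hvp x'
  have h4 : 0 < l'⁻¹^2 * v x' := by positivity
  have h5 : (0:ℝ)^2 * v x = 0 := by ring
  linarith

lemma v_form (hm : 1 ≤ m) (hu : Sol m u) (hdecay : Tendsto u (cocompact (EuclideanSpace ℝ (Fin (m+2)))) (𝓝 0)) :
    ∃ a b : ℝ, ∃ x₀ : EuclideanSpace ℝ (Fin (m+2)), 0 < a ∧ 0 < b ∧ ∀ x, (u x)^(-(2/(m:ℝ))) = a * ‖x - x₀‖^2 + b := by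
  have hB := allB hm hu hdecay
  choose l hl hB using hB
  set v : EuclideanSpace ℝ (Fin (m+2)) → ℝ := fun z => (u z)^(-(2/(m:ℝ))) with hv
  have hvp : ∀ z, 0 < v z := fun z => Real.rpow_pos_of_pos (hu.pos z) _
  have hvd : Differentiable ℝ v := v_diff hu
  have hev : ∀ x h, h ≠ 0 → QQ v x (l x) h =ᶠ[𝓝[>] 0] QQ v 0 (l 0) h := by
    intro x h hh
    filter_upwards [caseB_QQ hm hu.pos x h hh (hl x) (hB x), caseB_QQ hm hu.pos 0 h hh (hl 0) (hB 0)] with t e1 e2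
    rw [← e1, ← e2]
  have hzero : ∀ x h, h ≠ 0 → QQ v x (l x) h 0 = QQ v 0 (l 0) h 0 := by
    intro x h hh
    have t1 := (QQ_deriv hvd x h hh (hl x)).continuousAt.tendsto.mono_left (nhdsWithin_le_nhds (s := Set.Ioi 0))
    have t2 := (QQ_deriv hvd 0 h hh (hl 0)).continuousAt.tendsto.mono_left (nhdsWithin_le_nhds (s := Set.Ioi 0))
    exact tendsto_nhds_unique (t1.congr' (hev x h hh)) t2
  set a : ℝ := (l 0)⁻¹^2 * v 0 with ha
  have hapos : 0 < a := by
    have := hl 0; have := hvp 0; positivity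
  have hax : ∀ x, (l x)⁻¹^2 * v x = a := by
    intro x
    have hn : ‖(eb 0 : EuclideanSpace ℝ (Fin (m+2)))‖ = 1 := by simp
    have := hzero x (eb 0) (norm_ne_zero_iff.mp (by rw [hn]; norm_num))
    rw [QQ_zero, QQ_zero, hn] at this
    rw [ha]
    linarith
  have hder : ∀ x h, fderiv ℝ v x h = fderiv ℝ v 0 h + 2 * a * inner ℝ x h := by
    intro x h
    by_cases hh : h = 0
    · simp [hh]
    have d1 := (QQ_deriv hvd x h hh (hl x)).hasDerivWithinAt (s := Set.Ioi 0)
    have d2 := (QQ_deriv hvd 0 h hh (hl 0)).hasDerivWithinAt (s := Set.Ioi 0)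
    have d3 := d2.congr_of_eventuallyEq (hev x h hh) (hzero x h hh)
    have := (uniqueDiffWithinAt_Ioi (0:ℝ)).eq_deriv _ d1 d3
    rw [hax, hax] at this
    simp only [inner_zero_right, mul_zero, zero_add] at this
    rw [real_inner_comm x h] at this
    linarith
  set g := (InnerProductSpace.toDual ℝ (EuclideanSpace ℝ (Fin (m+2)))).symm (fderiv ℝ v 0) with hg
  have hgi : ∀ h, inner ℝ g h = fderiv ℝ v 0 h := fun h => by
    rw [hg]; exact InnerProductSpace.toDual_symm_apply
  have hconst : ∀ x, v x - a * ‖x‖^2 - fderiv ℝ v 0 x = v 0 := by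
    have hd : ∀ x, HasFDerivAt (fun x => v x - a * ‖x‖^2 - fderiv ℝ v 0 x) (0 : EuclideanSpace ℝ (Fin (m+2)) →L[ℝ] ℝ) x := by
      intro x
      have h1 := (((hvd x).hasFDerivAt.sub ((hasStrictFDerivAt_norm_sq x).hasFDerivAt.const_mul a)).sub
        (fderiv ℝ v 0).hasFDerivAt)
      refine h1.congr_fderiv ?_
      ext h
      simp [hder x h]
      ring
    intro x
    have := is_const_of_fderiv_eq_zero (𝕜 := ℝ) (fun x => (hd x).differentiableAt) (fun x => (hd x).fderiv) x 0
    simpa using this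
  have hsq : ∀ x, v x = a * ‖x - (-(2*a)⁻¹) • g‖^2 + (v 0 - a * ‖(-(2*a)⁻¹) • g‖^2) := by
    intro x
    have := hconst x
    rw [← hgi] at this
    rw [norm_sub_sq_real, inner_smul_right, real_inner_comm]
    have e : a * (2 * (-(2*a)⁻¹ * inner ℝ g x)) = - inner ℝ g x := by field_simp
    linarith
  refine ⟨a, _, (-(2*a)⁻¹) • g, hapos, ?_, hsq⟩
  have := hsq ((-(2*a)⁻¹) • g)
  rw [sub_self, norm_zero] at this
  have h2 := hvp ((-(2*a)⁻¹) • g)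
  linarith

lemma u_form (hm : 1 ≤ m) (hpos : ∀ y, 0 < u y) {a b : ℝ} {x₀ : EuclideanSpace ℝ (Fin (m+2))}
    (h : ∀ x, (u x)^(-(2/(m:ℝ))) = a * ‖x - x₀‖^2 + b) (x) : u x = (a * ‖x - x₀‖^2 + b)^(-((m:ℝ)/2)) := by
  rw [← h, ← Real.rpow_mul (hpos x).le]
  have : -(2/(m:ℝ)) * -((m:ℝ)/2) = 1 := by
    have hm0 : (m:ℝ) ≠ 0 := by positivity
    field_simp
  rw [this, Real.rpow_one]

lemma pde_const (hm : 1 ≤ m) (hu : Sol m u) {a b : ℝ} (ha : 0 < a) (hb : 0 < b) {x₀ : EuclideanSpace ℝ (Fin (m+2))}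
    (h : ∀ x, u x = (a * ‖x - x₀‖^2 + b)^(-((m:ℝ)/2))) : (m:ℝ) * (m+2) * a * b = 1 := by
  have hm0 : (0:ℝ) < m := by positivity
  have hpos : ∀ t : ℝ, 0 < a * t^2 + b := fun t => by positivity
  have hq : ∀ t : ℝ, HasDerivAt (fun t : ℝ => a * t^2 + b) (2 * a * t) t := fun t => by
    have := (((hasDerivAt_id t).pow 2).const_mul a).add_const b
    refine this.congr_deriv ?_
    simp; ring
  have hL : HasLap u x₀ (∑ _i : Fin (m+2), (-(m:ℝ) * a * b^(-((m:ℝ)/2) - 1))) := by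
    refine ⟨fun _ t => (2 * a * t) * (-((m:ℝ)/2)) * (a*t^2+b)^(-((m:ℝ)/2) - 1), fun _ => -(m:ℝ) * a * b^(-((m:ℝ)/2) - 1),
      fun i => Eventually.of_forall fun t => ?_, fun i => ?_, rfl⟩
    · have e : (fun t : ℝ => u (x₀ + t • eb i)) = fun t => (a*t^2+b)^(-((m:ℝ)/2)) := by
        ext t
        rw [h, add_sub_cancel_left, norm_smul]
        simp
      rw [e]
      exact (hq t).rpow_const (Or.inl (hpos t).ne')
    · have h1 : HasDerivAt (fun t : ℝ => (2 * a * t) * (-((m:ℝ)/2))) (-(m:ℝ) * a) 0 := by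
        have := ((hasDerivAt_id (0:ℝ)).const_mul (2*a)).mul_const (-((m:ℝ)/2))
        refine this.congr_deriv ?_
        ring
      have h2 := (hq 0).rpow_const (p := -((m:ℝ)/2) - 1) (Or.inl (hpos 0).ne')
      refine (h1.mul h2).congr_deriv ?_
      simp
  have := hL.unique (HasLap.of_contDiff hu.cd x₀)
  rw [hu.lap, h x₀] at this
  simp only [sub_self, norm_zero, Finset.sum_const, Finset.card_univ, Fintype.card_fin, nsmul_eq_mul] at this
  have e0 : a * 0^2 + b = b := by ring
  rw [e0, ← Real.rpow_mul hb.le] at this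
  have e1 : -((m:ℝ)/2) * (((m:ℝ)+4)/m) = -((m:ℝ)/2) - 1 - 1 := by field_simp; ring
  rw [e1, Real.rpow_sub_one hb.ne' (-((m:ℝ)/2) - 1)] at this
  have hp : 0 < b^(-((m:ℝ)/2) - 1) := Real.rpow_pos_of_pos hb _
  push_cast at this
  field_simp at this
  linarith

lemma final (hm : 1 ≤ m) (hu : Sol m u) (hdecay : Tendsto u (cocompact (EuclideanSpace ℝ (Fin (m+2)))) (𝓝 0)) :
    ∃ lam : ℝ, 0 < lam ∧ ∃ x₀ : EuclideanSpace ℝ (Fin (m+2)), ∀ x, u x =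
      (Real.sqrt (((m:ℝ)+2) * m) * lam / (lam ^ 2 + ‖x - x₀‖ ^ 2)) ^ ((m:ℝ)/2) := by
  obtain ⟨a, b, x₀, ha, hb, h⟩ := v_form hm hu hdecay
  have h1 := u_form hm hu.pos h
  have h2 := pde_const hm hu ha hb h1
  refine ⟨√(b/a), by positivity, x₀, fun x => ?_⟩
  rw [h1 x, Real.rpow_neg (by positivity), ← Real.inv_rpow (by positivity)]
  congr 1
  have e : √(((m:ℝ)+2)*m) * √(b/a) = 1/a := by
    rw [← Real.sqrt_mul (by positivity)]
    have : ((m:ℝ)+2)*m*(b/a) = (1/a)^2 := by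
      field_simp; linarith
    rw [this, Real.sqrt_sq (by positivity)]
  rw [e, Real.sq_sqrt (by positivity)]
  field_simp
  ring

end H

/-- **Classification of entire positive solutions at the energy-critical exponent**
(Theorem 3.4(ii), case Ω = ℝ^d). -/
theorem classification_energy_critical (d : ℕ) (hd : 3 ≤ d)
    (U : EuclideanSpace ℝ (Fin d) → ℝ)
    (hU : ContDiff ℝ 2 U) (hpos : ∀ x, 0 < U x)
    (hpde : ∀ x, -laplacian U x = U x ^ (((d : ℝ) + 2) / ((d : ℝ) - 2)))
    (hdecay : Tendsto U (cocompact (EuclideanSpace ℝ (Fin d))) (nhds 0)) :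
    ∃ lam : ℝ, 0 < lam ∧ ∃ x₀ : EuclideanSpace ℝ (Fin d),
      ∀ x, U x =
        (Real.sqrt ((d : ℝ) * ((d : ℝ) - 2)) * lam / (lam ^ 2 + ‖x - x₀‖ ^ 2)) ^
          (((d : ℝ) - 2) / 2) := by
  obtain ⟨m, rfl⟩ : ∃ m, d = m + 2 := ⟨d - 2, by omega⟩
  have hm : 1 ≤ m := by omega
  have e1 : ((m + 2 : ℕ) : ℝ) + 2 = (m:ℝ) + 4 := by push_cast; ring
  have e2 : ((m + 2 : ℕ) : ℝ) - 2 = (m:ℝ) := by push_cast; ring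
  have e3 : ((m + 2 : ℕ) : ℝ) = (m:ℝ) + 2 := by push_cast; ring
  simp only [e1, e2] at hpde
  have hsol : Sol m U := ⟨hU, hpos, fun y => by rw [← hpde y, neg_neg]⟩
  rw [e2, e3]
  exact final hm hsol hdecay
end
end
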